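/- arXiv:1902.06480 — 2 statements merged into one kernel-verified Lean document; each statement's English description precedes it below -/
import Mathlib

section
/- Ω = 0 is a zero of the characteristic function of the time-differentiated single layer: for every integer n ≥ 0, the function f₁(Ω) = -Σ_{m∈ℤ} i Ω_m H_n⁽¹⁾(Ω_m) J_n(Ω_m) φ̂_Δt(Ω_m), with Ω_m = Ω - 2mπ/Δt, extends continuously to Ω = 0 with value 0. -/
/-- Bessel function of the first kind of nonnegative integer order, via its power series. -/
noncomputable def besselJnat (n : ℕ) (z : ℂ) : ℂ :=
  ∑' k : ℕ, ((-1 : ℂ) ^ k / ((Nat.factorial k : ℂ) * (Nat.factorial (k + n) : ℂ)))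
    * (z / 2) ^ (2 * k + n)

/-- Bessel function of the first kind of integer order. -/
noncomputable def besselJ (n : ℤ) (z : ℂ) : ℂ :=
  if 0 ≤ n then besselJnat n.toNat z else (-1 : ℂ) ^ ((-n).toNat) * besselJnat (-n).toNat z

/-- Bessel function of the second kind of nonnegative integer order. -/
noncomputable def besselYnat (n : ℕ) (z : ℂ) : ℂ :=
  (2 / (Real.pi : ℂ)) * (Complex.log (z / 2) + (Real.eulerMascheroniConstant : ℂ))
      * besselJnat n z
  - (1 / (Real.pi : ℂ)) * ∑ k ∈ Finset.range n,
      ((Nat.factorial (n - 1 - k) : ℂ) / (Nat.factorial k : ℂ)) * (z / 2) ^ (2 * (k : ℤ) - n)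
  - (1 / (Real.pi : ℂ)) * ∑' k : ℕ,
      ((-1 : ℂ) ^ k * (((harmonic k : ℚ) + (harmonic (n + k) : ℚ) : ℚ) : ℂ)
        / ((Nat.factorial k : ℂ) * (Nat.factorial (n + k) : ℂ))) * (z / 2) ^ (2 * k + n)

/-- Bessel function of the second kind of integer order. -/
noncomputable def besselY (n : ℤ) (z : ℂ) : ℂ :=
  if 0 ≤ n then besselYnat n.toNat z else (-1 : ℂ) ^ ((-n).toNat) * besselYnat (-n).toNat z

/-- Hankel function of the first kind of integer order. -/
noncomputable def hankelH1 (n : ℤ) (z : ℂ) : ℂ := besselJ n z + Complex.I * besselY n z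

open Complex Filter

/-- The Fourier transform of the hat function, extended to complex arguments,
with `φ̂_Δt(0) = Δt`. -/
noncomputable def phiHatC (Δt : ℝ) (Ω : ℂ) : ℂ :=
  if Ω = 0 then (Δt : ℂ) else 2 / (Ω ^ 2 * Δt) * (1 - Complex.cos (Ω * Δt))

/-- The summand of the characteristic function of the time-differentiated single layer in
mode `n` (wave speed `c = 1`), with the convention that a summand with `Ω_m = 0` is taken as
its limit value `0`. -/
noncomputable def f1summand (Δt : ℝ) (n : ℤ) (Ω : ℂ) (m : ℤ) : ℂ :=
  if Ω - 2 * m * Real.pi / Δt = 0 then 0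
  else -(I * (Ω - 2 * m * Real.pi / Δt) * hankelH1 n (Ω - 2 * m * Real.pi / Δt)
    * besselJ n (Ω - 2 * m * Real.pi / Δt) * phiHatC Δt (Ω - 2 * m * Real.pi / Δt))

namespace BH

def Good (n : ℕ) (c : ℕ → ℂ) : Prop := ∀ r : ℝ, 0 ≤ r → Summable fun k => ‖c k‖ * r ^ (2 * k + n)

noncomputable def S (n : ℕ) (c : ℕ → ℂ) (z : ℂ) : ℂ := ∑' k : ℕ, c k * (z / 2) ^ (2 * k + n)

def th (n : ℕ) (c : ℕ → ℂ) (k : ℕ) : ℂ := ((2 * k + n : ℕ) : ℂ) * c k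

lemma Good.th {n : ℕ} {c : ℕ → ℂ} (h : Good n c) : Good n (th n c) := by
  intro r hr
  refine Summable.of_nonneg_of_le (fun k => by positivity) (fun k => ?_) (h (2 * r) (by positivity))
  have h1 : ((2 * k + n : ℕ) : ℝ) ≤ 2 ^ (2 * k + n) := by
    exact_mod_cast (Nat.lt_two_pow_self).le
  rw [BH.th, norm_mul, mul_pow, Complex.norm_natCast]
  have : 0 ≤ ‖c k‖ * r ^ (2 * k + n) := by positivity
  nlinarith [mul_le_mul_of_nonneg_right h1 this]

lemma Good.summable {n : ℕ} {c : ℕ → ℂ} (h : Good n c) (z : ℂ) :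
    Summable fun k => c k * (z / 2) ^ (2 * k + n) := by
  apply Summable.of_norm
  simpa [norm_mul, norm_pow] using h (‖z / 2‖) (norm_nonneg _)

lemma Good.diff {n : ℕ} {c : ℕ → ℂ} (h : Good n c) (z : ℂ) :
    DifferentiableAt ℂ (S n c) z ∧ z * deriv (S n c) z = S n (BH.th n c) z := by
  have hU : IsOpen (Metric.ball (0 : ℂ) (‖z‖ + 1)) := Metric.isOpen_ball
  have hz : z ∈ Metric.ball (0 : ℂ) (‖z‖ + 1) := by simp
  have hd : ∀ k : ℕ, DifferentiableOn ℂ (fun z : ℂ => c k * (z / 2) ^ (2 * k + n))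
      (Metric.ball (0 : ℂ) (‖z‖ + 1)) := fun k => by fun_prop
  have hb : ∀ (k : ℕ) (w : ℂ), w ∈ Metric.ball (0 : ℂ) (‖z‖ + 1) →
      ‖c k * (w / 2) ^ (2 * k + n)‖ ≤ ‖c k‖ * (‖z‖ + 1) ^ (2 * k + n) := by
    intro k w hw
    rw [norm_mul, norm_pow]
    have : ‖w / 2‖ ≤ ‖z‖ + 1 := by
      have : ‖w‖ < ‖z‖ + 1 := by simpa using hw
      rw [norm_div, Complex.norm_ofNat]
      linarith [norm_nonneg w]
    gcongr
  have hs := h (‖z‖ + 1) (by positivity)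
  constructor
  · exact (Complex.differentiableOn_tsum_of_summable_norm hs hd hU hb).differentiableAt
      (hU.mem_nhds hz)
  · have := (Complex.hasSum_deriv_of_summable_norm hs hd hU hb hz).mul_left z
    change z * deriv (fun w => ∑' (i : ℕ), c i * (w / 2) ^ (2 * i + n)) z = _
    rw [S, ← this.tsum_eq]
    refine tsum_congr fun k => ?_
    have h2 : HasDerivAt (fun z : ℂ => c k * (z / 2) ^ (2 * k + n))
      (c k * (((2 * k + n : ℕ) : ℂ) * (z / 2) ^ (2 * k + n - 1) * (1 / 2))) z :=
      (((hasDerivAt_id z).div_const 2).pow (2 * k + n)).const_mul (c k)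
    rw [h2.deriv, BH.th]
    rcases Nat.eq_zero_or_pos (2 * k + n) with h0 | h0
    · rw [h0]; simp
    · obtain ⟨p, hp⟩ : ∃ p, 2 * k + n = p + 1 := ⟨2 * k + n - 1, by omega⟩
      rw [hp]
      simp only [Nat.add_sub_cancel, pow_succ]
      ring

lemma Good.hasDerivAt {n : ℕ} {c : ℕ → ℂ} (h : Good n c) {z : ℂ} (hz : z ≠ 0) :
    HasDerivAt (S n c) (S n (BH.th n c) z / z) z := by
  obtain ⟨h1, h2⟩ := h.diff z
  rw [← h2, mul_div_cancel_left₀ _ hz]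
  exact h1.hasDerivAt

lemma S_ode {n : ℕ} {c d : ℕ → ℂ} (hc : Good n c) (hd : Good n d) (h0 : d 0 = 0)
    (hs : ∀ k : ℕ, d (k + 1) = (k + 1) * (k + 1 + n) * c (k + 1) + c k) (z : ℂ) :
    S n (th n (th n c)) z = (n ^ 2 - z ^ 2) * S n c z + 4 * S n d z := by
  have e1 : HasSum _ (S n (th n (th n c)) z) := (hc.th.th.summable z).hasSum
  have e2 : HasSum _ (S n c z) := (hc.summable z).hasSum
  have e3 : HasSum _ (S n d z) := (hd.summable z).hasSum
  have e4 := (e1.sub (e2.mul_left ((n : ℂ) ^ 2))).sub (e3.mul_left 4)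
  have e5 := e2.mul_left (-z ^ 2)
  rw [← hasSum_nat_add_iff' 1] at e4
  have := e4.unique (e5.congr_fun ?_) 
  · simp [th, h0] at this
    linear_combination this
  · intro k
    simp only [th, hs]
    push_cast
    rw [show 2 * (k + 1) + n = (2 * k + n) + 2 by ring, pow_add]
    ring

noncomputable def a (n k : ℕ) : ℂ := (-1 : ℂ) ^ k / ((Nat.factorial k : ℂ) * (Nat.factorial (k + n) : ℂ))

noncomputable def b (n k : ℕ) : ℂ := (-1 : ℂ) ^ k * (((harmonic k : ℚ) + (harmonic (n + k) : ℚ) : ℚ) : ℂ)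
        / ((Nat.factorial k : ℂ) * (Nat.factorial (n + k) : ℂ))

lemma good_a' (n m : ℕ) : Good n (a m) := by
  intro r hr
  refine Summable.of_nonneg_of_le (fun k => by positivity) (fun k => ?_)
    ((Real.summable_pow_div_factorial (r ^ 2)).mul_right (r ^ n))
  rw [a, norm_div, norm_pow, norm_neg, norm_one, one_pow, norm_mul, Complex.norm_natCast,
    Complex.norm_natCast, pow_add, pow_mul]
  have h1 : (1 : ℝ) ≤ (k + m).factorial := by exact_mod_cast Nat.factorial_pos _
  have h2 : (0 : ℝ) < k.factorial := by exact_mod_cast Nat.factorial_pos _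
  have : 1 / ((k.factorial : ℝ) * (k + m).factorial) ≤ 1 / k.factorial := by
    apply one_div_le_one_div_of_le h2
    nlinarith
  calc _ ≤ 1 / (k.factorial : ℝ) * ((r ^ 2) ^ k * r ^ n) := by gcongr
    _ = _ := by ring

lemma harm_le (k : ℕ) : harmonic k ≤ k := by
  induction k with
  | zero => simp
  | succ k ih =>
    rw [harmonic_succ]
    push_cast
    have : ((k + 1 : ℚ))⁻¹ ≤ 1 := inv_le_one_of_one_le₀ (by linarith [(Nat.cast_nonneg k : (0 : ℚ) ≤ k)])
    linarith

lemma harm_nonneg (k : ℕ) : 0 ≤ harmonic k := by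
  unfold harmonic
  positivity

lemma b_eq (n k : ℕ) : b n k = a n k * (((harmonic k + harmonic (n + k) : ℚ)) : ℂ) := by
  rw [a, b, add_comm k n]; ring

lemma good_b (n : ℕ) : Good n (b n) := by
  intro r hr
  refine Summable.of_nonneg_of_le (fun k => by positivity) (fun k => ?_)
    ((good_a' n n).th r hr)
  gcongr
  rw [b_eq, th, norm_mul, norm_mul, mul_comm]
  gcongr
  rw [Complex.norm_natCast, Complex.norm_ratCast]
  have h1 := harm_le k
  have h2 := harm_le (n + k)
  have h3 := harm_nonneg k
  have h4 := harm_nonneg (n + k)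
  rw [← Rat.cast_abs, abs_of_nonneg (by linarith)]
  have : harmonic k + harmonic (n + k) ≤ ((2 * k + n : ℕ) : ℚ) := by
    push_cast at *; linarith
  exact_mod_cast this

lemma a_succ (n k : ℕ) : (k + 1 : ℂ) * (k + 1 + n) * a n (k + 1) = - a n k := by
  have e : k + 1 + n = (k + n) + 1 := by ring
  simp only [a]
  rw [e, Nat.factorial_succ, Nat.factorial_succ, pow_succ]
  have h1 : (k + 1 : ℂ) ≠ 0 := by exact_mod_cast Nat.succ_ne_zero k
  have h2 : (k + n + 1 : ℂ) ≠ 0 := by exact_mod_cast Nat.succ_ne_zero (k + n)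
  have h3 : (k.factorial : ℂ) ≠ 0 := by exact_mod_cast Nat.factorial_ne_zero _
  have h4 : ((k + n).factorial : ℂ) ≠ 0 := by exact_mod_cast Nat.factorial_ne_zero _
  push_cast
  field_simp
  ring

lemma J_ode (n : ℕ) (z : ℂ) : S n (th n (th n (a n))) z = (n ^ 2 - z ^ 2) * S n (a n) z := by
  have := S_ode (d := fun _ => 0) (good_a' n n) (fun r hr => by simp) rfl
    (fun k => by rw [a_succ]; ring) z
  rw [this]; simp [S]

lemma T_ode (n : ℕ) (z : ℂ) : S n (th n (th n (b n))) z = (n ^ 2 - z ^ 2) * S n (b n) z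
    + 4 * (S n (th n (a n)) z - n / n.factorial * (z / 2) ^ n) := by
  have hg := (good_a' n n).th
  set d : ℕ → ℂ := fun k => if k = 0 then 0 else th n (a n) k with hd
  have hgd : Good n d := by
    intro r hr
    refine Summable.of_nonneg_of_le (fun k => by positivity) (fun k => ?_) (hg r hr)
    simp only [hd]
    split_ifs
    · simp; positivity
    · exact le_rfl
  rw [S_ode (good_b n) hgd rfl ?_ z]
  · congr 2
    have e1 := (hg.summable z).hasSum
    have e2 := (hgd.summable z).hasSum
    rw [← hasSum_nat_add_iff' 1] at e1 e2
    have := e2.unique (e1.congr_fun fun k => by simp [hd])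
    simp only [Finset.sum_range_one] at this
    simp [hd, th, a] at this
    simp only [S]
    simp [hd, th, a]
    linear_combination this
  · intro k
    simp only [hd]
    rw [if_neg (Nat.succ_ne_zero k), b_eq, b_eq, ← add_assoc, harmonic_succ, harmonic_succ, th]
    have h1 : (k + 1 : ℂ) ≠ 0 := by exact_mod_cast Nat.succ_ne_zero k
    have h2 : (n + k + 1 : ℂ) ≠ 0 := by exact_mod_cast Nat.succ_ne_zero (n + k)
    have := a_succ n k
    push_cast
    have e : a n k = - ((k + 1 : ℂ) * (k + 1 + n) * a n (k + 1)) := by rw [this]; ring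
    rw [e]
    field_simp
    ring

noncomputable def p (n k : ℕ) : ℂ := ((Nat.factorial (n - 1 - k) : ℂ) / (Nat.factorial k : ℂ))

lemma P_ode (n : ℕ) (t : ℂ) (ht : t ≠ 0) :
    ∑ k ∈ Finset.range n, p n k * (2 * k - n) ^ 2 * t ^ (2 * (k : ℤ) - n)
      = (n ^ 2 - (2 * t) ^ 2) * ∑ k ∈ Finset.range n, p n k * t ^ (2 * (k : ℤ) - n)
      + 4 * (n / n.factorial) * t ^ n := by
  have := Finset.sum_range_sub (fun k : ℕ => 4 * (k : ℂ) * (n - k).factorial / k.factorial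
    * t ^ (2 * (k : ℤ) - n)) n
  simp only [Nat.sub_self, Nat.factorial_zero, Nat.cast_one, mul_one, Nat.cast_zero, mul_zero,
    zero_div, zero_mul, sub_zero] at this
  have e : t ^ (2 * (n : ℤ) - n) = t ^ n := by
    rw [← zpow_natCast]; congr 1; ring
  rw [e] at this
  rw [show 4 * ((n : ℂ) / n.factorial) * t ^ n = 4 * (n : ℂ) / n.factorial * t ^ n by ring, ← this, Finset.mul_sum, ← Finset.sum_add_distrib]
  refine Finset.sum_congr rfl fun k hk => ?_
  have hk := Finset.mem_range.1 hk
  obtain ⟨j, rfl⟩ : ∃ j, n = k + 1 + j := ⟨n - (k + 1), by omega⟩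
  have e1 : k + 1 + j - k = j + 1 := by omega
  have e2 : k + 1 + j - (k + 1) = j := by omega
  have e3 : k + 1 + j - 1 - k = j := by omega
  have e4 : t ^ (2 * ((k + 1 : ℕ) : ℤ) - (k + 1 + j : ℕ)) = t ^ (2 * (k : ℤ) - (k + 1 + j : ℕ)) * t ^ 2 := by
    rw [← zpow_natCast t 2, ← zpow_add₀ ht]; congr 1; push_cast; ring
  rw [e4, e1, e2, p, e3, Nat.factorial_succ, Nat.factorial_succ]
  have h1 : (k + 1 : ℂ) ≠ 0 := by exact_mod_cast Nat.succ_ne_zero k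
  have h3 : (k.factorial : ℂ) ≠ 0 := by exact_mod_cast Nat.factorial_ne_zero _
  push_cast
  field_simp
  ring

lemma strip (n : ℕ) (f g : ℂ → ℂ)
    (hf : ∀ z : ℂ, 0 < z.re → HasDerivAt f (g z / z) z)
    (hg : ∀ z : ℂ, 0 < z.re → HasDerivAt g ((n ^ 2 - z ^ 2) * f z / z) z)
    (ρ : ℝ) (hρ : 0 < ρ) :
    ∃ K : ℝ, 0 ≤ K ∧ ∀ z : ℂ, ρ ≤ z.re → |z.im| ≤ 1 → ‖z‖ * ‖f z‖ ^ 2 ≤ K := by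
  set s : ℂ → ℂ := fun z => z ^ (1 / 2 : ℂ) with hs
  have hne : ∀ z : ℂ, 0 < z.re → z ≠ 0 := by
    rintro z hz rfl; simp at hz
  have hss : ∀ z : ℂ, 0 < z.re → s z * s z = z := by
    intro z hz
    simp only [hs]
    rw [← Complex.cpow_add _ _ (hne z hz)]; norm_num
  have hsne : ∀ z : ℂ, 0 < z.re → s z ≠ 0 := by
    intro z hz h
    have := hss z hz
    rw [h] at this
    exact hne z hz (by rw [← this]; simp)
  have hsd : ∀ z : ℂ, 0 < z.re → HasDerivAt s (s z / (2 * z)) z := by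
    intro z hz
    have := (hasDerivAt_id z).cpow_const (c := (1 / 2 : ℂ)) (Or.inl hz)
    refine this.congr_deriv ?_
    simp only [hs, id]
    rw [Complex.cpow_sub _ _ (hne z hz), Complex.cpow_one]
    ring
  set u : ℂ → ℂ := fun z => s z * f z with hu
  set v : ℂ → ℂ := fun z => (g z + f z / 2) / s z with hv
  have hud : ∀ z : ℂ, 0 < z.re → HasDerivAt u (v z) z := by
    intro z hz
    refine ((hsd z hz).mul (hf z hz)).congr_deriv ?_
    have h1 := hss z hz
    have h2 := hsne z hz
    have h3 := hne z hz
    simp only [hv]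
    field_simp
    rw [pow_two, h1]; ring
  have hvd : ∀ z : ℂ, 0 < z.re → HasDerivAt v (((n ^ 2 - 1 / 4) / z ^ 2 - 1) * u z) z := by
    intro z hz
    refine (((hg z hz).add ((hf z hz).div_const 2)).div (hsd z hz) (hsne z hz)).congr_deriv ?_
    have h1 := hss z hz
    have h2 := hsne z hz
    have h3 := hne z hz
    simp only [hu]
    simp only [Pi.add_apply]
    field_simp
    rw [pow_two (s z), h1]; ring
  set E : ℂ → ℝ := fun z => ‖u z‖ ^ 2 + ‖v z‖ ^ 2 with hE
  have hEc : ContinuousOn (fun y : ℝ => E ((ρ : ℂ) + y * I)) (Set.Icc (-1) 1) := by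
    intro y _
    apply ContinuousAt.continuousWithinAt
    have hp : 0 < ((ρ : ℂ) + y * I).re := by simpa using hρ
    have h1 : ContinuousAt (fun y : ℝ => (ρ : ℂ) + y * I) y := by fun_prop
    have h2 : ContinuousAt E ((ρ : ℂ) + y * I) :=
      ((hud _ hp).continuousAt.norm.pow 2).add ((hvd _ hp).continuousAt.norm.pow 2)
    exact ContinuousAt.comp (f := fun y : ℝ => (ρ : ℂ) + y * I) h2 h1
  obtain ⟨M, hM⟩ := isCompact_Icc.exists_bound_of_continuousOn hEc
  have hM0 : 0 ≤ M := le_trans (norm_nonneg _) (hM 0 (by simp))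
  set C : ℝ := n ^ 2 + 1 with hC
  have hC0 : 0 ≤ C := by positivity
  refine ⟨M * Real.exp (C / ρ), by positivity, fun z hz hzi => ?_⟩
  set y := z.im with hy
  have hline : ∀ x : ℝ, HasDerivAt (fun x : ℝ => (x : ℂ) + y * I) 1 x := fun x =>
    (Complex.ofRealCLM.hasDerivAt (x := x)).add_const (y * I)
  have hre : ∀ x : ℝ, ((x : ℂ) + y * I).re = x := fun x => by simp
  have hud' : ∀ x : ℝ, 0 < x → HasDerivAt (fun x : ℝ => u (x + y * I)) (v (x + y * I)) x := by
    intro x hx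
    have := (hud (x + y * I) (by rw [hre]; exact hx)).scomp x (hline x)
    rw [one_smul] at this
    exact this
  have hvd' : ∀ x : ℝ, 0 < x → HasDerivAt (fun x : ℝ => v (x + y * I))
      (((n ^ 2 - 1 / 4) / ((x : ℂ) + y * I) ^ 2 - 1) * u (x + y * I)) x := by
    intro x hx
    have := (hvd (x + y * I) (by rw [hre]; exact hx)).scomp x (hline x)
    rw [one_smul] at this
    exact this
  have hW : ∀ x : ℝ, 0 < x → HasDerivAt (fun x : ℝ => E (x + y * I) * Real.exp (C / x)) _ x :=
    fun x hx => ((hud' x hx).norm_sq.add (hvd' x hx).norm_sq).mul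
      (((hasDerivAt_inv hx.ne').const_mul C).exp)
  have hanti : AntitoneOn (fun x : ℝ => E (x + y * I) * Real.exp (C / x)) (Set.Ici ρ) := by
    apply antitoneOn_of_deriv_nonpos (convex_Ici ρ)
    · intro x hx
      exact (hW x (lt_of_lt_of_le hρ hx)).continuousAt.continuousWithinAt
    · intro x hx
      rw [interior_Ici] at hx
      exact (hW x (lt_trans hρ hx)).differentiableAt.differentiableWithinAt
    · intro x hx
      rw [interior_Ici] at hx
      have hx0 : 0 < x := lt_trans hρ hx
      rw [(hW x hx0).deriv]
      set U := u (x + y * I)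
      set V := v (x + y * I)
      set Q : ℂ := (n ^ 2 - 1 / 4) / ((x : ℂ) + y * I) ^ 2
      have hQ : ‖Q‖ ≤ C / x ^ 2 := by
        simp only [Q]
        rw [norm_div, norm_pow]
        have h1 : x ≤ ‖(x : ℂ) + y * I‖ := by
          have := Complex.re_le_norm ((x : ℂ) + y * I)
          rwa [hre] at this
        have h2 : ‖(n : ℂ) ^ 2 - 1 / 4‖ ≤ C := by
          refine (norm_sub_le _ _).trans ?_
          rw [norm_pow, Complex.norm_natCast]
          norm_num [hC]
        gcongr
      have hin : inner ℝ U V + inner ℝ V ((Q - 1) * U) = inner ℝ V (Q * U) := by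
        rw [sub_mul, one_mul, inner_sub_right, real_inner_comm]; ring
      have hle : inner ℝ V (Q * U) ≤ ‖V‖ * (‖Q‖ * ‖U‖) := by
        have := real_inner_le_norm V (Q * U)
        rwa [norm_mul] at this
      have hfin : 2 * inner ℝ U V + 2 * inner ℝ V ((Q - 1) * U) ≤ (‖U‖ ^ 2 + ‖V‖ ^ 2) * (C / x ^ 2) := by
        have h3 : 2 * (‖V‖ * ‖U‖) ≤ ‖U‖ ^ 2 + ‖V‖ ^ 2 := by nlinarith [sq_nonneg (‖U‖ - ‖V‖)]
        have h4 : (2 * (‖V‖ * ‖U‖)) * ‖Q‖ ≤ (‖U‖ ^ 2 + ‖V‖ ^ 2) * (C / x ^ 2) := by gcongr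
        nlinarith
      have hexp := Real.exp_pos (C * x⁻¹)
      have hk : (2 * inner ℝ U V + 2 * inner ℝ V ((Q - 1) * U) - (‖U‖ ^ 2 + ‖V‖ ^ 2) * (C / x ^ 2))
        * Real.exp (C * x⁻¹) ≤ 0 := mul_nonpos_of_nonpos_of_nonneg (by linarith) hexp.le
      refine le_trans (le_of_eq ?_) hk
      simp only [Pi.add_apply]
      change _ + (‖U‖ ^ 2 + ‖V‖ ^ 2) * _ = _
      ring
  have hzz : ((z.re : ℂ) + y * I) = z := by rw [hy]; exact Complex.re_add_im z
  have h1 := hanti (Set.mem_Ici.2 le_rfl) (Set.mem_Ici.2 hz) hz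
  simp only [hzz] at h1
  have hz0 : 0 < z.re := lt_of_lt_of_le hρ hz
  have h2 : ‖z‖ * ‖f z‖ ^ 2 ≤ E z := by
    simp only [hE, hu]
    rw [norm_mul, mul_pow, pow_two ‖s z‖, ← norm_mul, hss z hz0]
    nlinarith [sq_nonneg ‖v z‖]
  have h3 : 1 ≤ Real.exp (C / z.re) := Real.one_le_exp (by positivity)
  have hE0 : 0 ≤ E z := by positivity
  have h4 : E (ρ + y * I) ≤ M := le_trans (le_abs_self _) (hM y (abs_le.1 hzi))
  calc _ ≤ E z := h2
    _ ≤ E z * Real.exp (C / z.re) := le_mul_of_one_le_right hE0 h3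
    _ ≤ _ := h1
    _ ≤ _ := by gcongr

noncomputable def P (n : ℕ) (z : ℂ) : ℂ := ∑ k ∈ Finset.range n, p n k * (z / 2) ^ (2 * (k : ℤ) - n)

lemma J_eq (n : ℕ) (z : ℂ) : besselJnat n z = S n (a n) z := rfl

lemma Y_eq (n : ℕ) (z : ℂ) : besselYnat n z =
    (2 / (Real.pi : ℂ)) * (Complex.log (z / 2) + (Real.eulerMascheroniConstant : ℂ)) * S n (a n) z
    - (1 / (Real.pi : ℂ)) * P n z - (1 / (Real.pi : ℂ)) * S n (b n) z := rfl

lemma J_bound (n : ℕ) (ρ : ℝ) (hρ : 0 < ρ) :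
    ∃ K : ℝ, 0 ≤ K ∧ ∀ z : ℂ, ρ ≤ z.re → |z.im| ≤ 1 → ‖z‖ * ‖besselJnat n z‖ ^ 2 ≤ K := by
  have hne : ∀ z : ℂ, 0 < z.re → z ≠ 0 := by
    rintro z hz rfl; simp at hz
  refine strip n _ (S n (th n (a n))) (fun z hz => (good_a' n n).hasDerivAt (hne z hz))
    (fun z hz => ?_) ρ hρ
  rw [← J_ode]
  exact (good_a' n n).th.hasDerivAt (hne z hz)

lemma zpowsum_deriv (n : ℕ) (q : ℕ → ℂ) (z : ℂ) (hz : z ≠ 0) :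
    HasDerivAt (fun z : ℂ => ∑ k ∈ Finset.range n, q k * (z / 2) ^ (2 * (k : ℤ) - n))
      ((∑ k ∈ Finset.range n, q k * (2 * k - n) * (z / 2) ^ (2 * (k : ℤ) - n)) / z) z := by
  rw [Finset.sum_div]
  apply HasDerivAt.fun_sum
  intro k _
  have hz2 : z / 2 ≠ 0 := by simpa using hz
  have h := ((hasDerivAt_zpow (2 * (k : ℤ) - n) (z / 2) (Or.inl hz2)).comp z
    ((hasDerivAt_id z).div_const 2)).const_mul (q k)
  refine h.congr_deriv ?_
  rw [zpow_sub_one₀ hz2]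
  push_cast
  field_simp

lemma Y_bound (n : ℕ) (ρ : ℝ) (hρ : 0 < ρ) :
    ∃ K : ℝ, 0 ≤ K ∧ ∀ z : ℂ, ρ ≤ z.re → |z.im| ≤ 1 → ‖z‖ * ‖besselYnat n z‖ ^ 2 ≤ K := by
  have hne : ∀ z : ℂ, 0 < z.re → z ≠ 0 := by
    rintro z hz rfl; simp at hz
  have hlog : ∀ z : ℂ, 0 < z.re → HasDerivAt (fun z : ℂ => (2 / (Real.pi : ℂ)) *
      (Complex.log (z / 2) + (Real.eulerMascheroniConstant : ℂ))) ((2 / (Real.pi : ℂ)) * (1 / z)) z := by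
    intro z hz
    have h0 := hne z hz
    have h1 : z / 2 ∈ Complex.slitPlane := Or.inl (by
      simpa using hz)
    have h := ((((hasDerivAt_id z).div_const 2).clog h1).add_const
      (Real.eulerMascheroniConstant : ℂ)).const_mul (2 / (Real.pi : ℂ))
    refine h.congr_deriv ?_
    simp only [id]
    field_simp
  refine strip n _ (fun z => (2 / (Real.pi : ℂ)) * S n (a n) z + (2 / (Real.pi : ℂ)) *
      (Complex.log (z / 2) + (Real.eulerMascheroniConstant : ℂ)) * S n (th n (a n)) z
      - (1 / (Real.pi : ℂ)) * (∑ k ∈ Finset.range n, p n k * (2 * k - n) * (z / 2) ^ (2 * (k : ℤ) - n))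
      - (1 / (Real.pi : ℂ)) * S n (th n (b n)) z) (fun z hz => ?_)
    (fun z hz => ?_) ρ hρ
  · have h0 := hne z hz
    have h := (((hlog z hz).mul ((good_a' n n).hasDerivAt h0)).sub
      ((zpowsum_deriv n (p n) z h0).const_mul (1 / (Real.pi : ℂ)))).sub
      (((good_b n).hasDerivAt h0).const_mul (1 / (Real.pi : ℂ)))
    refine h.congr_deriv ?_
    field_simp
  · have h0 := hne z hz
    have h := (((((good_a' n n).hasDerivAt h0).const_mul (2 / (Real.pi : ℂ))).add
      ((hlog z hz).mul ((good_a' n n).th.hasDerivAt h0))).sub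
      ((zpowsum_deriv n (fun k => p n k * (2 * k - n)) z h0).const_mul (1 / (Real.pi : ℂ)))).sub
      (((good_b n).th.hasDerivAt h0).const_mul (1 / (Real.pi : ℂ)))
    refine h.congr_deriv ?_
    have hP := P_ode n (z / 2) (by simpa using h0)
    have hP' : ∑ k ∈ Finset.range n, p n k * (2 * k - n) * (2 * k - n) * (z / 2) ^ (2 * (k : ℤ) - n)
      = (n ^ 2 - z ^ 2) * P n z + 4 * (n / n.factorial) * (z / 2) ^ n := by
      rw [mul_div_cancel₀ z (two_ne_zero)] at hP
      rw [P, ← hP]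
      exact Finset.sum_congr rfl fun k _ => by ring
    rw [hP', Y_eq, J_ode, T_ode]
    have hpi : (Real.pi : ℂ) ≠ 0 := by exact_mod_cast Real.pi_ne_zero
    field_simp
    ring

lemma S_neg (n : ℕ) (c : ℕ → ℂ) (z : ℂ) : S n c (-z) = (-1) ^ n * S n c z := by
  rw [S, S, ← tsum_mul_left]
  refine tsum_congr fun k => ?_
  rw [neg_div, neg_pow, pow_add, pow_mul]
  norm_num
  ring

lemma P_neg (n : ℕ) (z : ℂ) : P n (-z) = (-1) ^ n * P n z := by
  rw [P, P, Finset.mul_sum]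
  refine Finset.sum_congr rfl fun k _ => ?_
  rw [neg_div, ← neg_one_mul, mul_zpow, zpow_sub₀ (by norm_num), zpow_mul]
  rcases Nat.even_or_odd n with h | h <;> simp [h.neg_one_pow] 

lemma log_neg_sub (w : ℂ) : ‖Complex.log (-w) - Complex.log w‖ ≤ 2 * Real.pi := by
  have : Complex.log (-w) - Complex.log w = ((-w).arg - w.arg : ℝ) * I := by
    apply Complex.ext <;> simp [Complex.log_re, Complex.log_im]
  rw [this, norm_mul, Complex.norm_I, mul_one, Complex.norm_real, Real.norm_eq_abs, abs_le]
  constructor <;> linarith [Complex.neg_pi_lt_arg w, Complex.arg_le_pi w,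
    Complex.neg_pi_lt_arg (-w), Complex.arg_le_pi (-w)]

lemma J_neg (n : ℕ) (z : ℂ) : ‖besselJnat n (-z)‖ = ‖besselJnat n z‖ := by
  rw [J_eq, J_eq, S_neg]; simp

lemma Y_neg (n : ℕ) (z : ℂ) : ‖besselYnat n (-z)‖ ≤ ‖besselYnat n z‖ + 4 * ‖besselJnat n z‖ := by
  have : besselYnat n (-z) = (-1) ^ n * (besselYnat n z + (2 / (Real.pi : ℂ)) *
      (Complex.log (-(z / 2)) - Complex.log (z / 2)) * besselJnat n z) := by
    rw [Y_eq, Y_eq, S_neg, S_neg, P_neg, neg_div, J_eq]; ring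
  rw [this, norm_mul, norm_pow, norm_neg, norm_one, one_pow, one_mul]
  refine (norm_add_le _ _).trans ?_
  rw [norm_mul, norm_mul, norm_div, Complex.norm_ofNat, Complex.norm_real, Real.norm_eq_abs,
    abs_of_pos Real.pi_pos]
  have h := log_neg_sub (z / 2)
  have hp := Real.pi_pos
  have : 2 / Real.pi * ‖Complex.log (-(z / 2)) - Complex.log (z / 2)‖ ≤ 4 := by
    calc _ ≤ 2 / Real.pi * (2 * Real.pi) := by gcongr
      _ = 4 := by field_simp; norm_num
  gcongr

lemma HJ_bound (n : ℕ) (ρ : ℝ) (hρ : 0 < ρ) :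
    ∃ K : ℝ, 0 ≤ K ∧ ∀ z : ℂ, ρ ≤ |z.re| → |z.im| ≤ 1 →
      ‖z * hankelH1 n z * besselJ n z‖ ≤ K := by
  obtain ⟨A, hA0, hA⟩ := J_bound n ρ hρ
  obtain ⟨B, hB0, hB⟩ := Y_bound n ρ hρ
  have hpos : ∀ z : ℂ, ρ ≤ z.re → |z.im| ≤ 1 → 
      ‖z‖ * ((5 * ‖besselJnat n z‖ + ‖besselYnat n z‖) * ‖besselJnat n z‖) ≤ 6 * A + B := by
    intro z h1 h2
    have hA := hA z h1 h2
    have hB := hB z h1 h2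
    have : (5 * ‖besselJnat n z‖ + ‖besselYnat n z‖) * ‖besselJnat n z‖ ≤
       6 * ‖besselJnat n z‖ ^ 2 + ‖besselYnat n z‖ ^ 2 := by
      nlinarith [sq_nonneg (‖besselJnat n z‖ - ‖besselYnat n z‖), sq_nonneg (‖besselJnat n z‖),
        sq_nonneg (‖besselYnat n z‖)]
    have := mul_le_mul_of_nonneg_left this (norm_nonneg z)
    linarith
  refine ⟨6 * A + B, by positivity, fun z h1 h2 => ?_⟩
  have hJ : ∀ z, besselJ n z = besselJnat n z := fun z => by simp [besselJ]
  have hY : ∀ z, besselY n z = besselYnat n z := fun z => by simp [besselY]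
  rw [hankelH1, hJ, hY, mul_assoc, norm_mul, norm_mul]
  have hN : ‖besselJnat n z + I * besselYnat n z‖ ≤ ‖besselJnat n z‖ + ‖besselYnat n z‖ := by
    refine (norm_add_le _ _).trans ?_
    simp
  rcases le_abs.1 h1 with h | h
  · refine le_trans ?_ (hpos z h h2)
    gcongr
    linarith [norm_nonneg (besselJnat n z)]
  · have := hpos (-z) (by simpa using h) (by simpa using h2)
    have e := Y_neg n (-z)
    rw [neg_neg] at e
    have e2 := J_neg n z
    rw [norm_neg] at this
    refine le_trans ?_ this
    rw [← e2] at hN ⊢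
    gcongr
    linarith

lemma S_factor (n : ℕ) (c : ℕ → ℂ) (z : ℂ) : S n c z = (z / 2) ^ n * S 0 c z := by
  rw [S, S, ← tsum_mul_left]
  refine tsum_congr fun k => ?_
  rw [pow_add]; simp; ring

lemma P_factor (n : ℕ) (z : ℂ) (hz : z ≠ 0) :
    P n z * (z / 2) ^ n = ∑ k ∈ Finset.range n, p n k * (z / 2) ^ (2 * k) := by
  have hz2 : z / 2 ≠ 0 := by simpa using hz
  rw [P, Finset.sum_mul]
  refine Finset.sum_congr rfl fun k _ => ?_
  rw [mul_assoc, ← zpow_natCast, ← zpow_add₀ hz2, ← zpow_natCast]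
  congr 2; push_cast; ring

lemma zlog_tendsto : Tendsto (fun z : ℂ => z * Complex.log (z / 2)) (nhds 0) (nhds 0) := by
  have h1 : Tendsto (fun z : ℂ => 2 * |‖z / 2‖ * Real.log ‖z / 2‖| + ‖z‖ * Real.pi) (nhds 0) (nhds 0) := by
    have : Continuous (fun z : ℂ => 2 * |‖z / 2‖ * Real.log ‖z / 2‖| + ‖z‖ * Real.pi) := by
      have := Real.continuous_mul_log.comp (show Continuous fun z : ℂ => ‖z / 2‖ by fun_prop)
      exact (continuous_const.mul this.abs).add (by fun_prop)
    simpa using this.tendsto 0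
  refine squeeze_zero_norm (fun z => ?_) h1
  have h2 : ‖Complex.log (z / 2)‖ ≤ |Real.log ‖z / 2‖| + Real.pi := by
    refine (Complex.norm_le_abs_re_add_abs_im _).trans ?_
    rw [Complex.log_re, Complex.log_im]
    gcongr
    exact Complex.abs_arg_le_pi _
  rw [norm_mul, abs_mul, abs_of_nonneg (norm_nonneg _)]
  have h3 : ‖z / 2‖ = ‖z‖ / 2 := by simp
  calc _ ≤ ‖z‖ * (|Real.log ‖z / 2‖| + Real.pi) := by gcongr
    _ = _ := by rw [h3]; ring

lemma zHJ_tendsto (n : ℕ) : Tendsto (fun z : ℂ => z * hankelH1 n z * besselJ n z)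
    (nhdsWithin 0 {0}ᶜ) (nhds 0) := by
  have cJ : ContinuousAt (S n (a n)) 0 := ((good_a' n n).diff 0).1.continuousAt
  have cJ0 : ContinuousAt (S 0 (a n)) 0 := ((good_a' 0 n).diff 0).1.continuousAt
  have cT : ContinuousAt (S n (b n)) 0 := ((good_b n).diff 0).1.continuousAt
  have cR : ContinuousAt (fun z : ℂ => ∑ k ∈ Finset.range n, p n k * (z / 2) ^ (2 * k)) 0 := by
    fun_prop
  have cL : ContinuousAt (fun z : ℂ => z * Complex.log (z / 2)) 0 := by
    have := zlog_tendsto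
    rw [ContinuousAt]; simpa using this
  set G : ℂ → ℂ := fun z => z * S n (a n) z ^ 2 + I * (
    (2 / (Real.pi : ℂ)) * (z * Complex.log (z / 2) + (Real.eulerMascheroniConstant : ℂ) * z) * S n (a n) z ^ 2
    - (1 / (Real.pi : ℂ)) * (z * (∑ k ∈ Finset.range n, p n k * (z / 2) ^ (2 * k)) * S 0 (a n) z)
    - (1 / (Real.pi : ℂ)) * (z * S n (b n) z * S n (a n) z)) with hG
  have cG : ContinuousAt G 0 := by
    have cid : ContinuousAt (fun z : ℂ => z) 0 := continuousAt_id
    exact (cid.mul (cJ.pow 2)).add (continuousAt_const.mul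
      (((((continuousAt_const.mul (cL.add (continuousAt_const.mul cid))).mul (cJ.pow 2)).sub
        (continuousAt_const.mul ((cid.mul cR).mul cJ0)))).sub
        (continuousAt_const.mul ((cid.mul cT).mul cJ))))
  have hG0 : G 0 = 0 := by simp [hG]
  have hT : Tendsto G (nhdsWithin 0 {0}ᶜ) (nhds 0) := by
    have := cG.tendsto.mono_left (nhdsWithin_le_nhds (s := {0}ᶜ))
    rwa [hG0] at this
  refine hT.congr' ?_
  filter_upwards [self_mem_nhdsWithin] with z hz
  have hz : z ≠ 0 := hz
  have hJ : besselJ n z = S n (a n) z := by simp [besselJ, J_eq]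
  have hY : besselY n z = besselYnat n z := by simp [besselY]
  have hP : P n z * S n (a n) z = (∑ k ∈ Finset.range n, p n k * (z / 2) ^ (2 * k)) * S 0 (a n) z := by
    rw [S_factor, ← mul_assoc, P_factor n z hz]
  rw [hankelH1, hJ, hY, Y_eq]
  simp only [hG]
  linear_combination (I * (1 / (Real.pi : ℂ)) * z) * hP

lemma one_sub_cos_bound : ∃ δ > 0, ∀ w : ℂ, ‖w‖ < δ → ‖1 - Complex.cos w‖ ≤ ‖w‖ ^ 2 := by
  have h := (Complex.hasDerivAt_sin 0).isLittleO
  have h2 := h.def (show (0 : ℝ) < 1 / 4 by norm_num)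
  rw [Metric.eventually_nhds_iff] at h2
  obtain ⟨ε, hε, h3⟩ := h2
  refine ⟨ε, hε, fun w hw => ?_⟩
  have h4 := @h3 (w / 2) (by
    simp only [dist_zero_right, norm_div, Complex.norm_ofNat]
    linarith [norm_nonneg w])
  simp only [Complex.sin_zero, sub_zero, Complex.cos_zero] at h4
  have h5 : ‖Complex.sin (w / 2)‖ ≤ 5 / 4 * ‖w / 2‖ := by
    have e : Complex.sin (w / 2) = (Complex.sin (w / 2) - w / 2) + w / 2 := by ring
    have h4' : ‖Complex.sin (w / 2) - w / 2‖ ≤ 1 / 4 * ‖w / 2‖ := by simpa using h4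
    rw [e]
    refine (norm_add_le _ _).trans ?_
    linarith
  have h6 : 1 - Complex.cos w = 2 * Complex.sin (w / 2) ^ 2 := by
    have e : w = 2 * (w / 2) := by ring
    conv_lhs => rw [e, Complex.cos_two_mul, Complex.cos_sq']
    ring
  rw [h6, norm_mul, norm_pow, Complex.norm_ofNat]
  have h7 : ‖w / 2‖ = ‖w‖ / 2 := by simp
  rw [h7] at h5
  have := pow_le_pow_left₀ (norm_nonneg _) h5 2
  nlinarith [sq_nonneg ‖w‖]

lemma term_zero (Δt : ℝ) (hΔt : 0 < Δt) (n : ℕ) :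
    Tendsto (fun Ω : ℂ => f1summand Δt n Ω 0) (nhdsWithin 0 {0}ᶜ) (nhds 0) := by
  obtain ⟨δ, hδ, hc⟩ := one_sub_cos_bound
  have h := (zHJ_tendsto n).norm.const_mul (2 * Δt)
  rw [norm_zero, mul_zero] at h
  refine squeeze_zero_norm' ?_ h
  have hb : ∀ᶠ z : ℂ in nhdsWithin 0 {0}ᶜ, ‖z‖ < δ / Δt := by
    apply nhdsWithin_le_nhds
    exact (continuous_norm.tendsto' (0 : ℂ) 0 norm_zero).eventually_lt_const (show 0 < δ / Δt by positivity)
  filter_upwards [self_mem_nhdsWithin, hb] with z hz hzb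
  have hz : z ≠ 0 := hz
  have e : z - 2 * ((0 : ℤ) : ℂ) * Real.pi / Δt = z := by simp
  rw [f1summand, e, if_neg hz, phiHatC, if_neg hz, norm_neg]
  have hcz := hc (z * Δt) (by
    rw [norm_mul, Complex.norm_real, Real.norm_eq_abs, abs_of_pos hΔt]
    rwa [lt_div_iff₀ hΔt] at hzb)
  have hφ : ‖2 / (z ^ 2 * Δt) * (1 - Complex.cos (z * Δt))‖ ≤ 2 * Δt := by
    rw [norm_mul, norm_div, norm_mul, norm_pow, Complex.norm_ofNat]
    rw [norm_mul] at hcz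
    rw [Complex.norm_real, Real.norm_eq_abs, abs_of_pos hΔt] at *
    have hzp : 0 < ‖z‖ := norm_pos_iff.2 hz
    calc _ ≤ 2 / (‖z‖ ^ 2 * Δt) * (‖z‖ * Δt) ^ 2 := by gcongr
      _ = _ := by field_simp
  rw [norm_mul, mul_comm (2 * Δt)]
  have e2 : ‖I * z * hankelH1 n z * besselJ n z‖ = ‖z * hankelH1 n z * besselJ n z‖ := by
    simp only [norm_mul, Complex.norm_I, one_mul]
  rw [e2]
  gcongr

lemma cos_shift (Δt : ℝ) (hΔt : 0 < Δt) (Ω : ℂ) (m : ℤ) :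
    Complex.cos ((Ω - 2 * m * Real.pi / Δt) * Δt) = Complex.cos (Ω * Δt) := by
  have h : (Δt : ℂ) ≠ 0 := by exact_mod_cast hΔt.ne'
  have : (Ω - 2 * m * Real.pi / Δt) * Δt = Ω * Δt - m * (2 * Real.pi) := by field_simp
  rw [this, Complex.cos_sub_int_mul_two_pi]

lemma term_bound (Δt : ℝ) (hΔt : 0 < Δt) (n : ℕ) :
    ∃ C : ℝ, 0 ≤ C ∧ ∀ᶠ Ω : ℂ in nhds 0, ∀ m : ℤ, m ≠ 0 →
      ‖f1summand Δt n Ω m‖ ≤ C * (1 / (m : ℝ) ^ 2) * ‖1 - Complex.cos (Ω * Δt)‖ := by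
  set ρ : ℝ := Real.pi / Δt with hρd
  have hρ : 0 < ρ := by have := Real.pi_pos; positivity
  obtain ⟨K, hK0, hK⟩ := HJ_bound n ρ hρ
  refine ⟨K * (2 / (ρ ^ 2 * Δt)), by positivity, ?_⟩
  have hb : ∀ᶠ z : ℂ in nhds 0, ‖z‖ < min 1 ρ := by
    exact (continuous_norm.tendsto' (0 : ℂ) 0 norm_zero).eventually_lt_const (lt_min one_pos hρ)
  filter_upwards [hb] with Ω hΩ m hm
  have hΩ1 : ‖Ω‖ < 1 := lt_of_lt_of_le hΩ (min_le_left _ _)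
  have hΩ2 : ‖Ω‖ < ρ := lt_of_lt_of_le hΩ (min_le_right _ _)
  have hcos := cos_shift Δt hΔt Ω m
  rw [f1summand]
  have hzd : Ω - 2 * m * Real.pi / Δt = Ω - ((2 * m * ρ : ℝ) : ℂ) := by
    rw [hρd]; push_cast; ring
  rw [hzd] at hcos ⊢
  set z : ℂ := Ω - ((2 * m * ρ : ℝ) : ℂ) with hz
  have hre : z.re = Ω.re - 2 * m * ρ := by rw [hz, Complex.sub_re, Complex.ofReal_re]
  have him : z.im = Ω.im := by rw [hz, Complex.sub_im, Complex.ofReal_im, sub_zero]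
  have hm1 : (1 : ℝ) ≤ |(m : ℝ)| := by exact_mod_cast Int.one_le_abs hm
  have hzr : |(m : ℝ)| * ρ ≤ |z.re| := by
    have h1 := Complex.abs_re_le_norm Ω
    have h2 : |2 * m * ρ| - |Ω.re| ≤ |z.re| := by
      rw [hre, abs_sub_comm]; exact abs_sub_abs_le_abs_sub _ _
    rw [abs_mul, abs_mul, abs_two, abs_of_pos hρ] at h2
    nlinarith
  have hzr2 : ρ ≤ |z.re| := by nlinarith
  have hzi : |z.im| ≤ 1 := by
    rw [him]; exact (Complex.abs_im_le_norm Ω).trans hΩ1.le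
  have hzn : |(m : ℝ)| * ρ ≤ ‖z‖ := hzr.trans (Complex.abs_re_le_norm z)
  have hz0 : z ≠ 0 := by
    intro h
    rw [h, norm_zero] at hzn
    nlinarith
  rw [if_neg hz0, phiHatC, if_neg hz0, hcos, norm_neg, norm_mul]
  have e2 : ‖I * z * hankelH1 n z * besselJ n z‖ = ‖z * hankelH1 n z * besselJ n z‖ := by
    simp only [norm_mul, Complex.norm_I, one_mul]
  rw [e2, norm_mul (2 / _), norm_div, norm_mul (z ^ 2), norm_pow, Complex.norm_ofNat,
    Complex.norm_real, Real.norm_eq_abs, abs_of_pos hΔt]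
  calc _ ≤ K * (2 / ((|(m : ℝ)| * ρ) ^ 2 * Δt) * ‖1 - Complex.cos (Ω * Δt)‖) := by
        gcongr
        exact hK z hzr2 hzi
    _ = _ := by
        rw [mul_pow, sq_abs]
        field_simp

end BH

/-- `Ω = 0` is a zero of the characteristic function of the time-differentiated single
layer: for every `n ≥ 0`, `f₁(Ω) = -Σ_m i Ω_m H_n⁽¹⁾(Ω_m) J_n(Ω_m) φ̂_Δt(Ω_m)` extends
continuously to `Ω = 0` with value `0`. -/
theorem f1_extends_continuously_to_zero (Δt : ℝ) (hΔt : 0 < Δt) (n : ℤ) (hn : 0 ≤ n) :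
    Tendsto (fun Ω : ℂ => ∑' m : ℤ, f1summand Δt n Ω m) (nhdsWithin 0 {0}ᶜ) (nhds 0) ∧
    (∑' m : ℤ, f1summand Δt n 0 m) = 0 := by
  lift n to ℕ using hn
  constructor
  · obtain ⟨C, hC0, hC⟩ := BH.term_bound Δt hΔt n
    have h0 := BH.term_zero Δt hΔt n
    have hcos : Tendsto (fun Ω : ℂ => ‖1 - Complex.cos (Ω * Δt)‖) (nhds 0) (nhds 0) := by
      have : Continuous (fun Ω : ℂ => ‖1 - Complex.cos (Ω * Δt)‖) := by fun_prop
      simpa using this.tendsto 0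
    have hsum : Summable (fun m : ℤ => C * (1 / (m : ℝ) ^ 2) + if m = 0 then (1 : ℝ) else 0) := by
      apply Summable.add
      · exact (Real.summable_one_div_int_pow.2 (by norm_num)).mul_left C
      · exact (hasSum_ite_eq (0 : ℤ) (1 : ℝ)).summable
    have key := tendsto_tsum_of_dominated_convergence (𝓕 := nhdsWithin (0 : ℂ) {0}ᶜ)
      (f := fun Ω m => f1summand Δt n Ω m) (g := fun _ : ℤ => (0 : ℂ)) hsum ?_ ?_
    · simpa using key
    · intro m
      by_cases hm : m = 0
      · subst hm; exact h0
      · apply squeeze_zero_norm' (a := fun Ω : ℂ =>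
          C * (1 / (m : ℝ) ^ 2) * ‖1 - Complex.cos (Ω * Δt)‖)
        · exact nhdsWithin_le_nhds (hC.mono fun Ω h => h m hm)
        · have := (hcos.const_mul (C * (1 / (m : ℝ) ^ 2))).mono_left
            (nhdsWithin_le_nhds (s := {0}ᶜ))
          simpa using this
    · have h1 : ∀ᶠ Ω : ℂ in nhdsWithin 0 {0}ᶜ, ‖f1summand Δt n Ω 0‖ < 1 := by
        have := h0.norm
        rw [norm_zero] at this
        exact this.eventually_lt_const (by norm_num)
      have h2 : ∀ᶠ Ω : ℂ in nhdsWithin 0 {0}ᶜ, ‖1 - Complex.cos (Ω * Δt)‖ < 1 :=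
        nhdsWithin_le_nhds (hcos.eventually_lt_const (by norm_num))
      filter_upwards [h1, h2, nhdsWithin_le_nhds hC] with Ω a1 a2 a3 m
      by_cases hm : m = 0
      · subst hm
        simpa using a1.le
      · rw [if_neg hm, add_zero]
        refine (a3 m hm).trans ?_
        exact mul_le_of_le_one_right (by positivity) a2.le
  · rw [← tsum_zero (β := ℤ)]
    refine tsum_congr fun m => ?_
    rw [f1summand]
    split_ifs with h
    · rfl
    · rw [phiHatC, if_neg h, BH.cos_shift Δt hΔt]
      simp
end

section
/- Zero is a characteristic root of the normal-derivative (D^{T-}) equation in mode 0: the function f₂(Ω) = Σ_{m∈ℤ} (Ω_m) H₀⁽¹⁾(Ω_m) J₀'(Ω_m) φ̂_Δt(Ω_m), with Ω_m = Ω - 2mπ/Δt and c = 1, extends continuously to Ω = 0 with f₂(0) = 0 (the m = 0 summand tends to 0 as Ω → 0 since J₀'(z) = -J₁(z) = O(z) and z H₀⁽¹⁾(z) = O(z log z), and the m ≠ 0 terms are purely a real-axis lattice sum whose value at Ω = 0 vanishes by the oddness pairing m ↔ -m). -/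
open Complex Filter

/-- The summand of the characteristic function of the normal-derivative `D^{T-}` equation in
mode `0` (wave speed `c = 1`), with the convention that a summand with `Ω_m = 0` is taken as
its limit value `0`. -/
noncomputable def f2summand (Δt : ℝ) (Ω : ℂ) (m : ℤ) : ℂ :=
  if Ω - 2 * m * Real.pi / Δt = 0 then 0
  else (Ω - 2 * m * Real.pi / Δt) * hankelH1 0 (Ω - 2 * m * Real.pi / Δt)
    * deriv (besselJ 0) (Ω - 2 * m * Real.pi / Δt) * phiHatC Δt (Ω - 2 * m * Real.pi / Δt)

lemma HasSum.congr_fun' {f g : ℕ → ℂ} {a : ℂ} (h : HasSum f a) (e : ∀ k, g k = f k) : HasSum g a := by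
  have : g = f := funext e
  rw [this]; exact h

noncomputable def psP (c : ℕ → ℂ) (t : ℂ) : ℂ := ∑' k : ℕ, c k * t ^ k
noncomputable def psD (c : ℕ → ℂ) (k : ℕ) : ℂ := ((k : ℂ) + 1) * c (k + 1)
def psB (c : ℕ → ℂ) : Prop := ∀ k, ‖c k‖ ≤ 1 / (Nat.factorial k : ℝ)

lemma psB_D {c : ℕ → ℂ} (h : psB c) : psB (psD c) := by
  intro k
  have h1 := h (k + 1)
  have h2 : ‖((k : ℂ) + 1)‖ = (k : ℝ) + 1 := by
    have := Complex.norm_natCast (k + 1)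
    push_cast at this
    exact this
  unfold psD
  rw [norm_mul, h2]
  have h3 : (0 : ℝ) < (k : ℝ) + 1 := by positivity
  calc ((k : ℝ) + 1) * ‖c (k + 1)‖ ≤ ((k : ℝ) + 1) * (1 / (Nat.factorial (k + 1) : ℝ)) := by gcongr
    _ = 1 / (Nat.factorial k : ℝ) := by
      rw [Nat.factorial_succ]; push_cast; field_simp

lemma psB_bound {c : ℕ → ℂ} (h : psB c) (R : ℝ) (t : ℂ) (ht : ‖t‖ ≤ R) (k : ℕ) :
    ‖c k * t ^ k‖ ≤ R ^ k / (Nat.factorial k : ℝ) := by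
  rw [norm_mul, norm_pow, div_eq_mul_one_div, mul_comm]
  have := h k
  have hR : 0 ≤ R := (norm_nonneg t).trans ht
  gcongr

lemma psB_summable {c : ℕ → ℂ} (h : psB c) (t : ℂ) : Summable (fun k => c k * t ^ k) :=
  Summable.of_norm_bounded (Real.summable_pow_div_factorial ‖t‖) (psB_bound h ‖t‖ t le_rfl)

lemma psP_hasDerivAt {c : ℕ → ℂ} (h : psB c) (t : ℂ) :
    HasDerivAt (psP c) (psP (psD c) t) t := by
  have hU : IsOpen (Metric.ball (0 : ℂ) (‖t‖ + 1)) := Metric.isOpen_ball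
  have hm : t ∈ Metric.ball (0 : ℂ) (‖t‖ + 1) := by simp
  have hd : ∀ k : ℕ, DifferentiableOn ℂ (fun s : ℂ => c k * s ^ k) (Metric.ball (0 : ℂ) (‖t‖ + 1)) := by
    intro k; fun_prop
  have hb : ∀ (k : ℕ) (w : ℂ), w ∈ Metric.ball (0 : ℂ) (‖t‖ + 1) →
      ‖c k * w ^ k‖ ≤ (‖t‖ + 1) ^ k / (Nat.factorial k : ℝ) := by
    intro k w hw
    exact psB_bound h _ w (by simpa using (mem_ball_zero_iff.mp hw).le) k
  have hs := Real.summable_pow_div_factorial (‖t‖ + 1)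
  have h1 := Complex.hasSum_deriv_of_summable_norm hs hd hU hb hm
  have h2 := (Complex.differentiableOn_tsum_of_summable_norm hs hd hU hb).differentiableAt
    (hU.mem_nhds hm)
  have h3 : deriv (psP c) t = psP (psD c) t := by
    have e := h1.tsum_eq
    have h4 := h1.summable
    rw [h4.tsum_eq_zero_add] at e
    unfold psP
    rw [← e]
    simp only [pow_zero, mul_one, deriv_const, zero_add]
    apply tsum_congr
    intro k
    rw [deriv_const_mul _ (by fun_prop)]
    simp [psD]
    ring
  rw [← h3]
  exact h2.hasDerivAt

lemma psP_ode {c e : ℕ → ℂ} (h : psB c) (he : psB e)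
    (hce : ∀ k : ℕ, ((k : ℂ) + 1) ^ 2 * c (k + 1) + c k = e k) (t : ℂ) :
    t * psP (psD (psD c)) t + psP (psD c) t + psP c t = psP e t := by
  have h0 := psB_summable h t
  have h1 := psB_summable (psB_D h) t
  have h2 := psB_summable (psB_D (psB_D h)) t
  have h3 := psB_summable he t
  -- t f'' = sum of k * d_k t^k
  have hg : HasSum (fun k : ℕ => (k : ℂ) * psD c k * t ^ k) (t * psP (psD (psD c)) t) := by
    have := h2.hasSum.mul_left t
    rw [hasSum_nat_add_iff' 1 |>.symm]
    simp only [Finset.range_one, Finset.sum_singleton, Nat.cast_zero, zero_mul, sub_zero]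
    refine this.congr_fun' ?_
    intro k
    simp only [psD]; push_cast; ring
  have hs := (hg.add h1.hasSum).add h0.hasSum
  refine hs.unique ?_
  refine h3.hasSum.congr_fun' ?_
  intro k
  rw [← hce k]; simp only [psD]; ring

noncomputable def jc (k : ℕ) : ℂ := (-1 : ℂ) ^ k / ((Nat.factorial k : ℂ) * (Nat.factorial k : ℂ))
noncomputable def sc (k : ℕ) : ℂ :=
  (-1 : ℂ) ^ k * ((harmonic k : ℚ) : ℂ) / ((Nat.factorial k : ℂ) * (Nat.factorial k : ℂ))

lemma jc_B : psB jc := by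
  intro k
  have h1 : (1 : ℝ) ≤ (Nat.factorial k : ℝ) := by exact_mod_cast Nat.one_le_iff_ne_zero.mpr (Nat.factorial_ne_zero k)
  simp only [jc, norm_div, norm_mul, norm_pow, norm_neg, norm_one, one_pow, Complex.norm_natCast]
  apply one_div_le_one_div_of_le (by positivity)
  nlinarith

lemma harm_bd (k : ℕ) : 0 ≤ harmonic k ∧ harmonic k ≤ (Nat.factorial k : ℚ) := by
  have key : 0 ≤ harmonic k ∧ harmonic k ≤ (k : ℚ) := by
    induction k with
    | zero => simp
    | succ n ih =>
      rw [harmonic_succ]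
      have : ((n + 1 : ℕ) : ℚ)⁻¹ ≤ 1 := by
        apply inv_le_one_of_one_le₀; push_cast; linarith [Nat.cast_nonneg (α := ℚ) n]
      have h0 : (0 : ℚ) ≤ ((n + 1 : ℕ) : ℚ)⁻¹ := by positivity
      refine ⟨by linarith [ih.1], ?_⟩
      have := ih.2
      push_cast at *
      linarith
  exact ⟨key.1, key.2.trans (by exact_mod_cast Nat.self_le_factorial k)⟩

lemma sc_B : psB sc := by
  intro k
  have h1 : (0 : ℝ) < (Nat.factorial k : ℝ) := by positivity
  have h2 : ‖((harmonic k : ℚ) : ℂ)‖ ≤ (Nat.factorial k : ℝ) := by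
    have : ((harmonic k : ℚ) : ℂ) = (((harmonic k : ℚ) : ℝ) : ℂ) := by push_cast; rfl
    rw [this, Complex.norm_real, Real.norm_eq_abs, abs_of_nonneg (by exact_mod_cast (harm_bd k).1)]
    exact_mod_cast (harm_bd k).2
  simp only [sc, norm_div, norm_mul, norm_pow, norm_neg, norm_one, one_pow, Complex.norm_natCast, one_mul]
  rw [div_le_div_iff₀ (by positivity) h1]
  nlinarith

lemma jc_ode (t : ℂ) : t * psP (psD (psD jc)) t + psP (psD jc) t + psP jc t = 0 := by
  have := psP_ode (e := fun _ => 0) jc_B (by intro k; simp) (by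
    intro k
    have hk : (k : ℂ) + 1 ≠ 0 := by exact_mod_cast Nat.succ_ne_zero k
    have hf : (Nat.factorial k : ℂ) ≠ 0 := by exact_mod_cast Nat.factorial_ne_zero k
    simp only [jc, Nat.factorial_succ]; push_cast
    field_simp
    ring) t
  rw [this]; simp [psP]

lemma sc_ode (t : ℂ) : t * psP (psD (psD sc)) t + psP (psD sc) t + psP sc t = psP (psD jc) t := by
  apply psP_ode sc_B (psB_D jc_B)
  intro k
  have hk : (k : ℂ) + 1 ≠ 0 := by exact_mod_cast Nat.succ_ne_zero k
  have hf : (Nat.factorial k : ℂ) ≠ 0 := by exact_mod_cast Nat.factorial_ne_zero k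
  simp only [sc, psD, jc, Nat.factorial_succ, harmonic_succ]; push_cast
  field_simp
  ring

lemma J_eq (z : ℂ) : besselJ 0 z = psP jc (z ^ 2 / 4) := by
  simp only [besselJ, le_refl, if_true, Int.toNat_zero, besselJnat, psP]
  apply tsum_congr
  intro k
  simp only [add_zero, jc, pow_mul]
  congr 2
  ring

lemma Y_eq (z : ℂ) : besselY 0 z = (2 / (Real.pi : ℂ)) *
    ((Complex.log (z / 2) + (Real.eulerMascheroniConstant : ℂ)) * psP jc (z ^ 2 / 4)
      - psP sc (z ^ 2 / 4)) := by
  have hJ := J_eq z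
  simp only [besselJ, le_refl, if_true, Int.toNat_zero] at hJ
  simp only [besselY, le_refl, if_true, Int.toNat_zero, besselYnat, hJ, Finset.range_zero,
    Finset.sum_empty]
  have : (∑' k : ℕ, ((-1 : ℂ) ^ k * (((harmonic k : ℚ) + (harmonic (0 + k) : ℚ) : ℚ) : ℂ)
        / ((Nat.factorial k : ℂ) * (Nat.factorial (0 + k) : ℂ))) * (z / 2) ^ (2 * k + 0))
      = 2 * psP sc (z ^ 2 / 4) := by
    rw [psP, ← tsum_mul_left]
    apply tsum_congr
    intro k
    have : (z / 2) ^ (2 * k + 0) = (z ^ 2 / 4) ^ k := by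
      rw [add_zero, pow_mul]; congr 1; ring
    rw [this]
    simp only [zero_add, sc]; push_cast; ring
  rw [this]
  ring

lemma sq_deriv (z : ℂ) : HasDerivAt (fun z : ℂ => z ^ 2 / 4) (z / 2) z := by
  have := ((hasDerivAt_id z).pow 2).div_const 4
  refine this.congr_deriv ?_
  simp; ring

lemma comp_deriv {c : ℕ → ℂ} (h : psB c) (z : ℂ) :
    HasDerivAt (fun z : ℂ => psP c (z ^ 2 / 4)) (psP (psD c) (z ^ 2 / 4) * (z / 2)) z :=
  HasDerivAt.comp (h₂ := psP c) (h := fun z : ℂ => z ^ 2 / 4) z (psP_hasDerivAt h (z ^ 2 / 4)) (sq_deriv z)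

lemma comp_deriv2 {c : ℕ → ℂ} (h : psB c) (z : ℂ) :
    HasDerivAt (fun z : ℂ => psP (psD c) (z ^ 2 / 4) * (z / 2))
      (psP (psD (psD c)) (z ^ 2 / 4) * (z / 2) * (z / 2) + psP (psD c) (z ^ 2 / 4) * (1 / 2)) z :=
  (comp_deriv (psB_D h) z).mul ((hasDerivAt_id z).div_const 2)

lemma J_deriv (z : ℂ) : HasDerivAt (besselJ 0) (psP (psD jc) (z ^ 2 / 4) * (z / 2)) z := by
  have : besselJ 0 = fun z => psP jc (z ^ 2 / 4) := funext J_eq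
  rw [this]; exact comp_deriv jc_B z

lemma J_deriv2 (z : ℂ) (hz : z ≠ 0) : HasDerivAt (deriv (besselJ 0))
    (- besselJ 0 z - deriv (besselJ 0) z / z) z := by
  have : deriv (besselJ 0) = fun z => psP (psD jc) (z ^ 2 / 4) * (z / 2) :=
    funext fun z => (J_deriv z).deriv
  rw [this]
  refine (comp_deriv2 jc_B z).congr_deriv ?_
  rw [J_eq]
  have := jc_ode (z ^ 2 / 4)
  field_simp
  linear_combination 4 * this

noncomputable def Y1 (z : ℂ) : ℂ := (2 / (Real.pi : ℂ)) *
    (z⁻¹ * psP jc (z ^ 2 / 4) + (Complex.log (z / 2) + (Real.eulerMascheroniConstant : ℂ)) *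
      (psP (psD jc) (z ^ 2 / 4) * (z / 2))
      - psP (psD sc) (z ^ 2 / 4) * (z / 2))

lemma log_deriv (z : ℂ) (hz : 0 < z.re) :
    HasDerivAt (fun z : ℂ => Complex.log (z / 2) + (Real.eulerMascheroniConstant : ℂ)) z⁻¹ z := by
  have hz0 : z ≠ 0 := by rintro rfl; simp at hz
  have h1 : z / 2 ∈ Complex.slitPlane := by
    left
    have : (z / 2).re = z.re / 2 := by simp
    rw [this]; linarith
  have := (((hasDerivAt_id z).div_const 2).clog h1).add_const (Real.eulerMascheroniConstant : ℂ)
  refine this.congr_deriv ?_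
  simp; field_simp

lemma Y_deriv (z : ℂ) (hz : 0 < z.re) : HasDerivAt (besselY 0) (Y1 z) z := by
  rw [show besselY 0 = _ from funext Y_eq]
  exact (((log_deriv z hz).mul (comp_deriv jc_B z)).sub (comp_deriv sc_B z)).const_mul _

lemma Y_deriv2 (z : ℂ) (hz : 0 < z.re) : HasDerivAt Y1 (- besselY 0 z - Y1 z / z) z := by
  have hz0 : z ≠ 0 := by rintro rfl; simp at hz
  have h := ((((hasDerivAt_inv hz0).mul (comp_deriv jc_B z)).add
    ((log_deriv z hz).mul (comp_deriv2 jc_B z))).sub (comp_deriv2 sc_B z)).const_mul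
      (2 / (Real.pi : ℂ))
  refine h.congr_deriv ?_
  rw [Y_eq, Y1]
  have h1 := jc_ode (z ^ 2 / 4)
  have h2 := sc_ode (z ^ 2 / 4)
  have hpi : (Real.pi : ℂ) ≠ 0 := by exact_mod_cast Real.pi_ne_zero
  generalize Complex.log (z / 2) + (Real.eulerMascheroniConstant : ℂ) = L at *
  field_simp
  linear_combination (4 * L * z ^ 2) * h1 - 4 * z ^ 2 * h2

lemma energy_ineq (x y a b p q : ℝ) (hx : 1 ≤ x) (hy : |y| ≤ 1) :
    (a^2+b^2+p^2+q^2) + x * (2*a*p+2*b*q + 2*p*(-a-(p*x+q*y)/(x^2+y^2))+2*q*(-b-(q*x-p*y)/(x^2+y^2)))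
      + (p*p + a*(-a-(p*x+q*y)/(x^2+y^2)) + (q*q + b*(-b-(q*x-p*y)/(x^2+y^2))))
      ≤ 6 / x^2 * (x*(a^2+b^2+p^2+q^2)+(a*p+b*q)) := by
  have hD : 0 < x^2+y^2 := by positivity
  have hx0 : 0 < x := by linarith
  obtain ⟨hy1, hy2⟩ := abs_le.mp hy
  set E := a^2+b^2+p^2+q^2 with hE
  have hE0 : 0 ≤ E := by positivity
  have h1 : 3 * E / x ≤ 6 / x^2 * (x*E+(a*p+b*q)) := by
    rw [div_mul_eq_mul_div, div_le_div_iff₀ hx0 (by positivity)]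
    have : x * E ≤ 2 * (x*E+(a*p+b*q)) := by
      nlinarith [sq_nonneg (a+p), sq_nonneg (b+q)]
    nlinarith [mul_nonneg hx0.le hx0.le]
  refine le_trans ?_ h1
  have h2 : E + x * (2*a*p+2*b*q + 2*p*(-a-(p*x+q*y)/(x^2+y^2))+2*q*(-b-(q*x-p*y)/(x^2+y^2)))
      + (p*p + a*(-a-(p*x+q*y)/(x^2+y^2)) + (q*q + b*(-b-(q*x-p*y)/(x^2+y^2))))
      = (2*(p^2+q^2)*y^2 - ((a*p+b*q)*x+(a*q-b*p)*y))/(x^2+y^2) := by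
    rw [hE]; field_simp; ring
  rw [h2, div_le_div_iff₀ hD hx0]
  have hA : -(E/2) ≤ a*p+b*q := by nlinarith [sq_nonneg (a+p), sq_nonneg (b+q)]
  have hB : (a*q-b*p) ≤ E/2 := by nlinarith [sq_nonneg (a-q), sq_nonneg (b+p)]
  have hB' : -(E/2) ≤ (a*q-b*p) := by nlinarith [sq_nonneg (a+q), sq_nonneg (b-p)]
  have hC : -(E/2) ≤ (a*q-b*p)*y := by nlinarith
  have hA2 : -(E/2)*x ≤ (a*p+b*q)*x := by gcongr
  have hy3 : y^2 ≤ 1 := by nlinarith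
  have hP : (p^2+q^2)*y^2 ≤ E := by nlinarith [sq_nonneg a, sq_nonneg b, sq_nonneg p, sq_nonneg q]
  have hEx : E ≤ E * x := by nlinarith
  have : (2*(p^2+q^2)*y^2 - ((a*p+b*q)*x+(a*q-b*p)*y)) ≤ 3 * E * x := by nlinarith
  calc _ ≤ 3 * E * x * x := by gcongr
    _ ≤ _ := by nlinarith [mul_nonneg hE0 (sq_nonneg y)]

lemma energy_line (y : ℝ) (hy : |y| ≤ 1) (w w1 : ℂ → ℂ)
    (hw : ∀ z : ℂ, 0 < z.re → HasDerivAt w (w1 z) z)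
    (hw1 : ∀ z : ℂ, 0 < z.re → HasDerivAt w1 (-w z - w1 z / z) z) (x : ℝ) (hx : 1 ≤ x) :
    x * (‖w ⟨x, y⟩‖^2 + ‖w1 ⟨x, y⟩‖^2) ≤
      1000 * 6 ^ 6 * (‖w ⟨1, y⟩‖^2 + ‖w1 ⟨1, y⟩‖^2) := by
  have hl : ∀ s : ℝ, HasDerivAt (fun s : ℝ => (⟨s, y⟩ : ℂ)) 1 s := by
    intro s
    have h := (Complex.ofRealCLM.hasDerivAt (x := s)).add_const (y * Complex.I)
    have e : (fun s : ℝ => (⟨s, y⟩ : ℂ)) = fun s : ℝ => Complex.ofRealCLM s + y * Complex.I := by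
      funext s; apply Complex.ext <;> simp
    rw [e]
    exact h.congr_deriv (by simp)
  have hre : ∀ (g g' : ℂ → ℂ) (s : ℝ), HasDerivAt g (g' ⟨s, y⟩) ⟨s, y⟩ →
      HasDerivAt (fun s : ℝ => (g ⟨s, y⟩).re) (g' ⟨s, y⟩).re s ∧
      HasDerivAt (fun s : ℝ => (g ⟨s, y⟩).im) (g' ⟨s, y⟩).im s := by
    intro g g' s h
    have h1 : HasDerivAt (fun s : ℝ => g ⟨s, y⟩) (g' ⟨s, y⟩) s := by
      exact (HasDerivAt.scomp (h := fun s : ℝ => (⟨s, y⟩ : ℂ)) s h (hl s)).congr_deriv (by simp)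
    exact ⟨Complex.reCLM.hasFDerivAt.comp_hasDerivAt s h1,
      Complex.imCLM.hasFDerivAt.comp_hasDerivAt s h1⟩
  set a : ℝ → ℝ := fun s => (w ⟨s, y⟩).re with ha
  set b : ℝ → ℝ := fun s => (w ⟨s, y⟩).im with hb
  set p : ℝ → ℝ := fun s => (w1 ⟨s, y⟩).re with hp
  set q : ℝ → ℝ := fun s => (w1 ⟨s, y⟩).im with hq
  have da : ∀ s, 1 ≤ s → HasDerivAt a (p s) s := fun s hs =>
    (hre w w1 s (hw _ (by simp; linarith))).1
  have db : ∀ s, 1 ≤ s → HasDerivAt b (q s) s := fun s hs =>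
    (hre w w1 s (hw _ (by simp; linarith))).2
  have dp : ∀ s, 1 ≤ s → HasDerivAt p (-a s-(p s*s+q s*y)/(s^2+y^2)) s := by
    intro s hs
    convert (hre w1 (fun z => -w z - w1 z / z) s (hw1 _ (by simp; linarith))).1 using 1
    simp [ha, hp, hq, Complex.div_re, Complex.normSq_apply]
    ring
  have dq : ∀ s, 1 ≤ s → HasDerivAt q (-b s-(q s*s-p s*y)/(s^2+y^2)) s := by
    intro s hs
    convert (hre w1 (fun z => -w z - w1 z / z) s (hw1 _ (by simp; linarith))).2 using 1
    simp [hb, hp, hq, Complex.div_im, Complex.normSq_apply]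
    ring
  set F : ℝ → ℝ := fun s => s * (a s^2 + b s^2 + p s^2 + q s^2) + (a s * p s + b s * q s) with hF
  have dF : ∀ s, 1 ≤ s → ∃ F', HasDerivAt F F' s ∧ F' ≤ 6 / s^2 * F s := by
    intro s hs
    have h := ((hasDerivAt_id s).mul (((((da s hs).pow 2).add ((db s hs).pow 2)).add
      ((dp s hs).pow 2)).add ((dq s hs).pow 2))).add
      (((da s hs).mul (dp s hs)).add ((db s hs).mul (dq s hs)))
    refine ⟨_, h, ?_⟩
    refine le_trans (le_of_eq ?_) (energy_ineq s y (a s) (b s) (p s) (q s) hs hy)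
    simp
    try ring
  set G : ℝ → ℝ := fun s => F s * Real.exp (6 / s) with hG
  have dG : ∀ s, 1 ≤ s → ∃ G', HasDerivAt G G' s ∧ G' ≤ 0 := by
    intro s hs
    obtain ⟨F', h1, h2⟩ := dF s hs
    have hs0 : s ≠ 0 := by linarith
    have h3 : HasDerivAt (fun s : ℝ => 6 / s) (-(6 / s^2)) s := by
      have := (hasDerivAt_inv hs0).const_mul (6:ℝ)
      simpa [div_eq_mul_inv] using this
    refine ⟨_, h1.mul h3.exp, ?_⟩
    have := Real.exp_pos (6 / s)
    have e : F' * Real.exp (6 / s) + F s * (Real.exp (6 / s) * -(6 / s^2))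
      = (F' - 6 / s^2 * F s) * Real.exp (6 / s) := by ring
    rw [e]
    exact mul_nonpos_of_nonpos_of_nonneg (by linarith) this.le
  have hanti : AntitoneOn G (Set.Ici 1) := by
    apply antitoneOn_of_deriv_nonpos (convex_Ici 1)
    · intro s hs
      obtain ⟨G', h, _⟩ := dG s hs
      exact h.continuousAt.continuousWithinAt
    · intro s hs
      rw [interior_Ici] at hs
      obtain ⟨G', h, _⟩ := dG s (le_of_lt hs)
      exact h.differentiableAt.differentiableWithinAt
    · intro s hs
      rw [interior_Ici] at hs
      obtain ⟨G', h, h'⟩ := dG s (le_of_lt hs)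
      rw [h.deriv]; exact h'
  have hle : G x ≤ G 1 := hanti (Set.mem_Ici.mpr le_rfl) hx hx
  have hn : ∀ s, ‖w ⟨s, y⟩‖^2 + ‖w1 ⟨s, y⟩‖^2 = a s^2 + b s^2 + p s^2 + q s^2 := by
    intro s
    rw [Complex.sq_norm, Complex.sq_norm, Complex.normSq_apply, Complex.normSq_apply]
    simp only [ha, hb, hp, hq]; ring
  rw [hn, hn]
  have hlow : x * (a x^2 + b x^2 + p x^2 + q x^2) ≤ 2 * F x := by
    simp only [hF]
    nlinarith [sq_nonneg (a x+p x), sq_nonneg (b x+q x), sq_nonneg (a x), sq_nonneg (b x), sq_nonneg (p x), sq_nonneg (q x)]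
  have hup : F 1 ≤ 2 * (a 1^2 + b 1^2 + p 1^2 + q 1^2) := by
    simp only [hF]
    nlinarith [sq_nonneg (a 1-p 1), sq_nonneg (b 1-q 1)]
  have hFx : 0 ≤ F x := by
    have : 0 ≤ x * (a x^2 + b x^2 + p x^2 + q x^2) := by positivity
    linarith
  have h1 : F x ≤ G x := by
    have : 1 ≤ Real.exp (6 / x) := Real.one_le_exp (by positivity)
    simp only [hG]; nlinarith
  have h2 : Real.exp (6 / 1) ≤ 3 ^ 6 := by
    have : Real.exp (6/1) = Real.exp 1 ^ 6 := by rw [← Real.exp_nat_mul]; norm_num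
    rw [this]
    gcongr
    exact Real.exp_one_lt_three.le
  have h3 : G 1 ≤ 2 * (a 1^2 + b 1^2 + p 1^2 + q 1^2) * 3^6 := by
    simp only [hG]
    calc _ ≤ 2 * (a 1^2 + b 1^2 + p 1^2 + q 1^2) * Real.exp (6/1) := by gcongr
      _ ≤ _ := by gcongr
  have hpos : 0 ≤ a 1^2 + b 1^2 + p 1^2 + q 1^2 := by positivity
  nlinarith

lemma energy_bound (d : ℝ) (hd : 0 < d) (w w1 : ℂ → ℂ)
    (hw : ∀ z : ℂ, 0 < z.re → HasDerivAt w (w1 z) z)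
    (hw1 : ∀ z : ℂ, 0 < z.re → HasDerivAt w1 (-w z - w1 z / z) z) :
    ∃ C : ℝ, 0 ≤ C ∧ ∀ z : ℂ, d ≤ z.re → |z.im| ≤ 1 →
      z.re * (‖w z‖^2 + ‖w1 z‖^2) ≤ C := by
  set e := min d 1 with he
  have he0 : 0 < e := lt_min hd one_pos
  have hK : IsCompact (Set.Icc e 1 ×ℂ Set.Icc (-1) 1) := isCompact_Icc.reProdIm isCompact_Icc
  have hc : ContinuousOn (fun z => ‖w z‖^2 + ‖w1 z‖^2) (Set.Icc e 1 ×ℂ Set.Icc (-1) 1) := by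
    intro z hz
    have hz' : 0 < z.re := lt_of_lt_of_le he0 hz.1.1
    exact (((hw z hz').continuousAt.norm.pow 2).add
      ((hw1 z hz').continuousAt.norm.pow 2)).continuousWithinAt
  obtain ⟨M, hM⟩ := hK.exists_bound_of_continuousOn hc
  have hM' : ∀ z : ℂ, e ≤ z.re → z.re ≤ 1 → |z.im| ≤ 1 → ‖w z‖^2 + ‖w1 z‖^2 ≤ M := by
    intro z h1 h2 h3
    exact (le_abs_self _).trans (hM z ⟨⟨h1, h2⟩, abs_le.mp h3⟩)
  have hM0 : 0 ≤ M := le_trans (by positivity) (hM' ⟨1, 0⟩ (min_le_right _ _) le_rfl (by simp))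
  refine ⟨1000 * 6 ^ 6 * M, by positivity, ?_⟩
  intro z h1 h2
  rcases le_total z.re 1 with h | h
  · have := hM' z ((min_le_left _ _).trans h1) h h2
    have h0 : 0 ≤ ‖w z‖^2 + ‖w1 z‖^2 := by positivity
    nlinarith
  · have := energy_line z.im h2 w w1 hw hw1 z.re h
    have h' := hM' ⟨1, z.im⟩ (min_le_right _ _) le_rfl h2
    exact this.trans (by gcongr)

lemma log_neg_bd (w : ℂ) : ‖Complex.log (-w) - Complex.log w‖ ≤ 2 * Real.pi := by
  have e : Complex.log (-w) - Complex.log w = ((Complex.arg (-w) - Complex.arg w : ℝ) : ℂ) * Complex.I := by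
    simp only [Complex.log, norm_neg]; push_cast; ring
  rw [e, norm_mul, Complex.norm_I, mul_one, Complex.norm_real, Real.norm_eq_abs]
  have h1 := abs_le.mp (Complex.abs_arg_le_pi w)
  have h2 := abs_le.mp (Complex.abs_arg_le_pi (-w))
  rw [abs_le]; constructor <;> linarith [h1.1, h1.2, h2.1, h2.2]

lemma J_neg (z : ℂ) : besselJ 0 (-z) = besselJ 0 z := by
  rw [J_eq, J_eq]; congr 2; ring

lemma J1_neg (z : ℂ) : deriv (besselJ 0) (-z) = - deriv (besselJ 0) z := by
  rw [(J_deriv z).deriv, (J_deriv (-z)).deriv, neg_sq]; ring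

lemma Y_neg (z : ℂ) : ‖besselY 0 (-z)‖ ≤ ‖besselY 0 z‖ + 4 * ‖besselJ 0 z‖ := by
  have e : besselY 0 (-z) = besselY 0 z +
      (2 / (Real.pi : ℂ)) * ((Complex.log (-(z / 2)) - Complex.log (z / 2)) * besselJ 0 z) := by
    rw [Y_eq, Y_eq, J_eq, neg_sq, neg_div]; ring
  rw [e]
  refine (norm_add_le _ _).trans ?_
  gcongr
  have hp := Real.pi_pos
  rw [norm_mul, norm_mul, norm_div, Complex.norm_real, Real.norm_eq_abs, abs_of_pos hp,
    Complex.norm_ofNat]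
  have := log_neg_bd (z / 2)
  calc 2 / Real.pi * (‖Complex.log (-(z / 2)) - Complex.log (z / 2)‖ * ‖besselJ 0 z‖)
      ≤ 2 / Real.pi * (2 * Real.pi * ‖besselJ 0 z‖) := by gcongr
    _ = 4 * ‖besselJ 0 z‖ := by field_simp; ring

lemma H_norm (z : ℂ) : ‖hankelH1 0 z‖ ≤ ‖besselJ 0 z‖ + ‖besselY 0 z‖ := by
  unfold hankelH1
  refine (norm_add_le _ _).trans ?_
  simp

lemma main_bound (d : ℝ) (hd : 0 < d) : ∃ C : ℝ, 0 ≤ C ∧ ∀ z : ℂ, d ≤ |z.re| → |z.im| ≤ 1 →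
    ‖hankelH1 0 z‖ * ‖deriv (besselJ 0) z‖ ≤ C / |z.re| := by
  obtain ⟨C1, h10, h1⟩ := energy_bound d hd (besselJ 0) (deriv (besselJ 0))
    (fun z _ => (J_deriv z).differentiableAt.hasDerivAt)
    (fun z hz => J_deriv2 z (by rintro rfl; simp at hz))
  obtain ⟨C2, h20, h2⟩ := energy_bound d hd (besselY 0) Y1 Y_deriv Y_deriv2
  refine ⟨3 * C1 + C2, by positivity, ?_⟩
  have key : ∀ z : ℂ, d ≤ z.re → |z.im| ≤ 1 →
      (5 * ‖besselJ 0 z‖ + ‖besselY 0 z‖) * ‖deriv (besselJ 0) z‖ ≤ (3 * C1 + C2) / z.re := by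
    intro z hz hy
    have a1 := h1 z hz hy
    have a2 := h2 z hz hy
    have hx : 0 < z.re := by linarith
    rw [le_div_iff₀ hx]
    have b : (5 * ‖besselJ 0 z‖ + ‖besselY 0 z‖) * ‖deriv (besselJ 0) z‖ ≤
        3 * (‖besselJ 0 z‖^2 + ‖deriv (besselJ 0) z‖^2) + (‖besselY 0 z‖^2 + ‖Y1 z‖^2) := by
      nlinarith [sq_nonneg (‖besselJ 0 z‖ - ‖deriv (besselJ 0) z‖),
        sq_nonneg (‖besselY 0 z‖ - ‖deriv (besselJ 0) z‖), sq_nonneg (‖Y1 z‖),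
        sq_nonneg (‖besselJ 0 z‖), sq_nonneg (‖besselY 0 z‖)]
    nlinarith
  intro z hz hy
  rcases le_total 0 z.re with h | h
  · rw [abs_of_nonneg h] at hz ⊢
    refine le_trans ?_ (key z hz hy)
    gcongr
    have := H_norm z
    linarith [norm_nonneg (besselJ 0 z)]
  · rw [abs_of_nonpos h] at hz ⊢
    have := key (-z) (by simpa using hz) (by simpa using hy)
    rw [Complex.neg_re] at this
    refine le_trans ?_ this
    rw [J1_neg, norm_neg]
    gcongr
    have h3 := H_norm z
    have h4 := Y_neg (-z)
    rw [neg_neg] at h4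
    rw [J_neg] at h4 ⊢
    linarith

lemma summand_eq (Δt : ℝ) (hΔt : 0 < Δt) (Ω : ℂ) (m : ℤ) (h : Ω - 2 * m * Real.pi / Δt ≠ 0) :
    f2summand Δt Ω m = (2 / Δt) * (1 - Complex.cos (Ω * Δt)) *
      (hankelH1 0 (Ω - 2 * m * Real.pi / Δt) * deriv (besselJ 0) (Ω - 2 * m * Real.pi / Δt)) /
        (Ω - 2 * m * Real.pi / Δt) := by
  have hD : (Δt : ℂ) ≠ 0 := by exact_mod_cast hΔt.ne'
  have hc : Complex.cos ((Ω - 2 * m * Real.pi / Δt) * Δt) = Complex.cos (Ω * Δt) := by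
    have : (Ω - 2 * m * Real.pi / Δt) * Δt = Ω * Δt - m * (2 * Real.pi) := by field_simp
    rw [this, Complex.cos_sub_int_mul_two_pi]
  rw [f2summand, if_neg h, phiHatC, if_neg h, hc]
  generalize Ω - 2 * m * Real.pi / Δt = z at *
  field_simp

lemma summand_zero (Δt : ℝ) (hΔt : 0 < Δt) (m : ℤ) : f2summand Δt 0 m = 0 := by
  by_cases h : (0 : ℂ) - 2 * m * Real.pi / Δt = 0
  · rw [f2summand, if_pos h]
  · rw [summand_eq Δt hΔt 0 m h]; simp

lemma zlog_tendsto : Tendsto (fun z : ℂ => z * Complex.log (z / 2)) (nhds 0) (nhds 0) := by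
  have hb : ∀ z : ℂ, ‖z * Complex.log (z / 2)‖ ≤
      2 * |‖z / 2‖ * Real.log ‖z / 2‖| + Real.pi * ‖z‖ := by
    intro z
    have h1 : ‖Complex.log (z / 2)‖ ≤ |Real.log ‖z / 2‖| + Real.pi := by
      refine (Complex.norm_le_abs_re_add_abs_im _).trans ?_
      rw [Complex.log_re, Complex.log_im]
      gcongr
      exact Complex.abs_arg_le_pi _
    have h2 : ‖z / 2‖ = ‖z‖ / 2 := by simp
    rw [norm_mul, abs_mul, abs_of_nonneg (norm_nonneg (z / 2))]
    have : ‖z‖ * ‖Complex.log (z / 2)‖ ≤ ‖z‖ * (|Real.log ‖z / 2‖| + Real.pi) := by gcongr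
    refine this.trans (le_of_eq ?_)
    rw [h2]; ring
  have hc : Continuous (fun z : ℂ => 2 * |‖z / 2‖ * Real.log ‖z / 2‖| + Real.pi * ‖z‖) := by
    have := Real.continuous_mul_log.comp (f := fun z : ℂ => ‖z / 2‖) (by fun_prop)
    have h : Continuous (fun z : ℂ => ‖z / 2‖ * Real.log ‖z / 2‖) := this
    fun_prop
  have ht := hc.tendsto 0
  simp only [zero_div, norm_zero, zero_mul, abs_zero, mul_zero, add_zero] at ht
  exact squeeze_zero_norm hb ht

lemma ps_cont {c : ℕ → ℂ} (h : psB c) : Continuous (fun z : ℂ => psP c (z ^ 2 / 4)) :=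
  continuous_iff_continuousAt.mpr fun z => (comp_deriv h z).continuousAt

lemma zH_tendsto : Tendsto (fun z : ℂ => z * hankelH1 0 z) (nhds 0) (nhds 0) := by
  have hJ := (ps_cont jc_B).tendsto 0
  have hS := (ps_cont sc_B).tendsto 0
  have hid : Tendsto (fun z : ℂ => z) (nhds 0) (nhds 0) := tendsto_id
  have h := (hid.mul hJ).add ((((zlog_tendsto.add
    (hid.mul_const (Real.eulerMascheroniConstant : ℂ))).mul hJ).sub (hid.mul hS)).const_mul
      (Complex.I * (2 / (Real.pi : ℂ))))
  simp only [zero_mul, add_zero, sub_zero, mul_zero] at h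
  refine h.congr ?_
  intro z
  rw [hankelH1, J_eq, Y_eq]
  ring

lemma summand_tendsto_zero (Δt : ℝ) (hΔt : 0 < Δt) :
    Tendsto (fun Ω : ℂ => f2summand Δt Ω 0) (nhdsWithin 0 {0}ᶜ) (nhds 0) := by
  have hcos : HasDerivAt (fun Ω : ℂ => Complex.cos (Ω * Δt)) 0 0 := by
    have := ((hasDerivAt_id (0 : ℂ)).mul_const (Δt : ℂ)).ccos
    exact this.congr_deriv (by simp)
  have hs := hcos.tendsto_slope
  have h1 := (ps_cont (psB_D jc_B)).tendsto 0 |>.mono_left (nhdsWithin_le_nhds (s := {0}ᶜ))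
  have h2 := zH_tendsto.mono_left (nhdsWithin_le_nhds (s := {0}ᶜ))
  have h := ((hs.mul h2).mul h1).const_mul (-(1 / (Δt : ℂ)))
  simp only [zero_mul, mul_zero] at h
  refine h.congr' ?_
  filter_upwards [self_mem_nhdsWithin] with z hz
  have hz : z ≠ 0 := hz
  have hD : (Δt : ℂ) ≠ 0 := by exact_mod_cast hΔt.ne'
  have hz' : z - 2 * ((0 : ℤ) : ℂ) * Real.pi / Δt = z := by simp
  rw [summand_eq Δt hΔt z 0 (by rw [hz']; exact hz), hz', (J_deriv z).deriv, slope_def_field]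
  simp only [zero_mul, Complex.cos_zero, sub_zero]
  field_simp
  ring

lemma summand_bound (Δt : ℝ) (hΔt : 0 < Δt) : ∃ K : ℝ, 0 ≤ K ∧ ∀ Ω : ℂ, ‖Ω‖ ≤ 1 →
    ‖Ω‖ ≤ Real.pi / Δt → ∀ m : ℤ, m ≠ 0 →
    ‖f2summand Δt Ω m‖ ≤ ‖1 - Complex.cos (Ω * Δt)‖ * (K * (1 / (m : ℝ) ^ 2)) := by
  have hp := Real.pi_pos
  set d := Real.pi / Δt with hd
  have hd0 : 0 < d := by positivity
  obtain ⟨C, hC0, hC⟩ := main_bound d hd0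
  refine ⟨2 / Δt * C / d ^ 2, by positivity, ?_⟩
  intro Ω h1 h2 m hm
  have hm1 : (1 : ℝ) ≤ |(m : ℝ)| := by exact_mod_cast Int.one_le_abs hm
  set z := Ω - 2 * m * Real.pi / Δt with hz
  have hzz : z = Ω - ((2 * m * d : ℝ) : ℂ) := by rw [hz, hd]; push_cast; ring
  have hre : z.re = Ω.re - 2 * m * d := by rw [hzz, Complex.sub_re, Complex.ofReal_re]
  have him : z.im = Ω.im := by rw [hzz, Complex.sub_im, Complex.ofReal_im, sub_zero]
  have hx : |(m : ℝ)| * d ≤ |z.re| := by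
    have a1 := (Complex.abs_re_le_norm Ω).trans h2
    have a2 : |2 * m * d| ≤ |z.re| + |Ω.re| := by
      have : 2 * m * d = Ω.re - z.re := by rw [hre]; ring
      rw [this]; linarith [abs_sub Ω.re z.re]
    rw [abs_mul, abs_mul, abs_of_pos hd0, abs_two] at a2
    nlinarith
  have hx0 : 0 < |(m : ℝ)| * d := by positivity
  have hdx : d ≤ |z.re| := by nlinarith
  have hb := hC z hdx (by rw [him]; exact (Complex.abs_im_le_norm Ω).trans h1)
  have hzn : |z.re| ≤ ‖z‖ := Complex.abs_re_le_norm z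
  have hz0 : z ≠ 0 := by
    intro h; rw [h] at hdx; simp at hdx; linarith
  rw [summand_eq Δt hΔt Ω m hz0, ← hz, norm_div, norm_mul, norm_mul, norm_mul (hankelH1 0 z)]
  have hn : ‖(2 / (Δt : ℂ))‖ = 2 / Δt := by
    rw [norm_div, Complex.norm_real, Real.norm_eq_abs, abs_of_pos hΔt, Complex.norm_ofNat]
  rw [hn]
  calc 2 / Δt * ‖1 - Complex.cos (Ω * Δt)‖ * (‖hankelH1 0 z‖ * ‖deriv (besselJ 0) z‖) / ‖z‖
      ≤ 2 / Δt * ‖1 - Complex.cos (Ω * Δt)‖ * (C / (|(m : ℝ)| * d)) / (|(m : ℝ)| * d) := by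
        gcongr
        · exact hb.trans (by gcongr)
        · exact hx.trans hzn
    _ = _ := by
        rw [← sq_abs (m : ℝ)]
        field_simp

/-- Zero is a characteristic root of the normal-derivative equation in mode `0`:
`f₂(Ω) = Σ_m Ω_m H₀⁽¹⁾(Ω_m) J₀'(Ω_m) φ̂_Δt(Ω_m)` extends continuously to `Ω = 0` with
value `f₂(0) = 0`. -/
theorem f2_extends_continuously_to_zero (Δt : ℝ) (hΔt : 0 < Δt) :
    Tendsto (fun Ω : ℂ => ∑' m : ℤ, f2summand Δt Ω m) (nhdsWithin 0 {0}ᶜ) (nhds 0) ∧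
    (∑' m : ℤ, f2summand Δt 0 m) = 0 := by
  refine ⟨?_, by simp [summand_zero Δt hΔt]⟩
  obtain ⟨K, hK0, hK⟩ := summand_bound Δt hΔt
  have hp : 0 < Real.pi / Δt := by have := Real.pi_pos; positivity
  have e1 : ∀ᶠ Ω : ℂ in nhdsWithin 0 {0}ᶜ, ‖Ω‖ ≤ 1 ∧ ‖Ω‖ ≤ Real.pi / Δt := by
    apply Filter.Eventually.filter_mono nhdsWithin_le_nhds
    filter_upwards [Metric.ball_mem_nhds (0 : ℂ) one_pos, Metric.ball_mem_nhds (0 : ℂ) hp] with Ω a b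
    exact ⟨(mem_ball_zero_iff.mp a).le, (mem_ball_zero_iff.mp b).le⟩
  have hcos : Tendsto (fun Ω : ℂ => ‖1 - Complex.cos (Ω * Δt)‖) (nhdsWithin 0 {0}ᶜ) (nhds 0) := by
    have : Continuous (fun Ω : ℂ => ‖1 - Complex.cos (Ω * Δt)‖) := by fun_prop
    have := this.tendsto 0
    simp only [zero_mul, Complex.cos_zero, sub_self, norm_zero] at this
    exact this.mono_left nhdsWithin_le_nhds
  have e2 : ∀ᶠ Ω : ℂ in nhdsWithin 0 {0}ᶜ, ‖1 - Complex.cos (Ω * Δt)‖ < 1 :=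
    hcos.eventually (gt_mem_nhds one_pos)
  have h0 := summand_tendsto_zero Δt hΔt
  have e3 : ∀ᶠ Ω : ℂ in nhdsWithin 0 {0}ᶜ, ‖f2summand Δt Ω 0‖ < 1 := by
    have := h0.norm
    rw [norm_zero] at this
    exact this.eventually (gt_mem_nhds one_pos)
  have hsum : Summable (fun m : ℤ => K * (1 / (m : ℝ) ^ 2) + if m = 0 then (1 : ℝ) else 0) := by
    apply Summable.add
    · exact (Real.summable_one_div_int_pow.mpr one_lt_two).mul_left K
    · exact (hasSum_ite_eq (0 : ℤ) (1 : ℝ)).summable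
  have main := tendsto_tsum_of_dominated_convergence (𝓕 := nhdsWithin (0 : ℂ) {0}ᶜ)
    (f := fun Ω m => f2summand Δt Ω m) (g := fun _ : ℤ => (0 : ℂ)) hsum ?_ ?_
  · simpa using main
  · intro m
    by_cases hm : m = 0
    · subst hm; exact h0
    · apply squeeze_zero_norm' (a := fun Ω : ℂ => ‖1 - Complex.cos (Ω * Δt)‖ * (K * (1 / (m : ℝ) ^ 2)))
      · filter_upwards [e1] with Ω h
        exact hK Ω h.1 h.2 m hm
      · have h5 := hcos.mul_const (K * (1 / (m : ℝ) ^ 2))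
        rw [zero_mul] at h5
        exact h5
  · filter_upwards [e1, e2, e3] with Ω h1 h2 h3 m
    by_cases hm : m = 0
    · subst hm; simpa using h3.le
    · have := hK Ω h1.1 h1.2 m hm
      rw [if_neg hm, add_zero]
      have hpos : 0 ≤ K * (1 / (m : ℝ) ^ 2) := by positivity
      nlinarith
end
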